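/- arXiv:1511.07020 — 3 statements merged into one kernel-verified Lean document; each statement's English description precedes it below -/
import Mathlib

section
/- For every initial condition s ∈ ℝⁿ_{>0}, the Physarum dynamics ẋ = q − x has a unique solution x : [0,∞) → ℝⁿ_{>0} with x(0) = s. -/
open Matrix Filter Set Topology

/-- The real matrix obtained from an integer matrix by coercion of entries. -/
noncomputable def rmat {m n : ℕ} (A : Matrix (Fin m) (Fin n) ℤ) :
    Matrix (Fin m) (Fin n) ℝ :=
  A.map (Int.cast : ℤ → ℝ)

/-- The diagonal matrix `W = diag (x i / c i)`. -/
noncomputable def physW {n : ℕ} (c x : Fin n → ℝ) : Matrix (Fin n) (Fin n) ℝ :=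
  Matrix.diagonal (fun i => x i / c i)

/-- The Physarum vector `q = W Aᵀ L⁻¹ b` where `L = A W Aᵀ`. -/
noncomputable def physQ {m n : ℕ} (B : Matrix (Fin m) (Fin n) ℝ) (b : Fin m → ℝ)
    (c x : Fin n → ℝ) : Fin n → ℝ :=
  physW c x *ᵥ (Bᵀ *ᵥ ((B * physW c x * Bᵀ)⁻¹ *ᵥ b))

/-- The set of absolute values of determinants of square submatrices of `A` (as reals). -/
def subdets {m n : ℕ} (A : Matrix (Fin m) (Fin n) ℤ) : Set ℝ :=
  {d | ∃ (k : ℕ) (f : Fin k → Fin m) (g : Fin k → Fin n),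
    Function.Injective f ∧ Function.Injective g ∧
    d = |((A.submatrix f g).det : ℝ)|}

/-- `x` is a solution of the Physarum dynamics `ẋ = q - x` on the time set `s`,
staying in the positive orthant. -/
def IsPhysSolOn {m n : ℕ} (B : Matrix (Fin m) (Fin n) ℝ) (b : Fin m → ℝ)
    (c : Fin n → ℝ) (x : ℝ → Fin n → ℝ) (s : Set ℝ) : Prop :=
  ∀ t ∈ s, (∀ i, 0 < x t i) ∧ HasDerivWithinAt x (physQ B b c (x t) - x t) s t

lemma phys_inj {m n : ℕ} {B : Matrix (Fin m) (Fin n) ℝ} (hB : B.rank = m)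
    {p : Fin m → ℝ} (hp : Bᵀ *ᵥ p = 0) : p = 0 := by
  have h1 : LinearIndependent ℝ B.row := by
    rw [linearIndependent_iff_card_eq_finrank_span, Set.finrank, ← Matrix.rank_eq_finrank_span_row, hB]
    simp
  have h2 := Matrix.vecMul_injective_iff.2 h1
  apply h2
  simpa [Matrix.mulVec_transpose] using hp

lemma phys_diag_mulVec {n : ℕ} (w u : Fin n → ℝ) :
    Matrix.diagonal w *ᵥ u = fun i => w i * u i := by
  ext i; simp [Matrix.mulVec_diagonal]

lemma phys_unit {m n : ℕ} {B : Matrix (Fin m) (Fin n) ℝ} (hB : B.rank = m)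
    {w : Fin n → ℝ} (hw : ∀ i, 0 < w i) : IsUnit (B * Matrix.diagonal w * Bᵀ).det := by
  rw [← Matrix.isUnit_iff_isUnit_det, ← Matrix.mulVec_injective_iff_isUnit]
  rw [← Matrix.coe_mulVecLin, injective_iff_map_eq_zero]
  intro p hp
  rw [Matrix.mulVecLin_apply, ← Matrix.mulVec_mulVec, ← Matrix.mulVec_mulVec, phys_diag_mulVec] at hp
  apply phys_inj hB
  have h : ∑ i, w i * (Bᵀ *ᵥ p) i ^ 2 = 0 := by
    have h2 : p ⬝ᵥ (B *ᵥ fun i => w i * (Bᵀ *ᵥ p) i) = 0 := by rw [hp]; simp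
    rw [Matrix.dotProduct_mulVec, ← Matrix.mulVec_transpose] at h2
    rw [← h2, dotProduct]
    exact Finset.sum_congr rfl fun i _ => by ring
  rw [Finset.sum_eq_zero_iff_of_nonneg (fun i _ => mul_nonneg (hw i).le (sq_nonneg _))] at h
  ext i
  have := h i (Finset.mem_univ i)
  simpa [(hw i).ne'] using this

lemma phys_dst {m n : ℕ} (B : Matrix (Fin m) (Fin n) ℝ) :
    ∃ K : ℝ, ∀ (p : Fin m → ℝ) (v w : Fin n → ℝ), (∀ i, 0 < w i) →
      B *ᵥ (fun i => w i * ((Bᵀ *ᵥ p) i - v i)) = 0 → ‖Bᵀ *ᵥ p‖ ≤ K * ‖v‖ := by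
  by_contra! hcon
  choose p v w hw h0 hlt using fun N : ℕ => hcon ((N : ℝ) + 1)
  set a : ℕ → ℝ := fun N => ‖Bᵀ *ᵥ p N‖ with ha
  have hapos : ∀ N, 0 < a N := fun N => lt_of_le_of_lt (by positivity) (hlt N)
  set u : ℕ → Fin n → ℝ := fun N => (a N)⁻¹ • (Bᵀ *ᵥ p N) with hu
  have hun : ∀ N, ‖u N‖ = 1 := by
    intro N
    rw [hu]; simp only [norm_smul, norm_inv, Real.norm_eq_abs, abs_of_pos (hapos N)]
    exact inv_mul_cancel₀ (hapos N).ne'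
  have hur : ∀ N, u N ∈ LinearMap.range (Bᵀ).mulVecLin := by
    intro N
    exact Submodule.smul_mem _ _ ⟨p N, rfl⟩
  have hcl : IsClosed ((LinearMap.range (Bᵀ).mulVecLin : Submodule ℝ (Fin n → ℝ)) : Set (Fin n → ℝ)) :=
    Submodule.closed_of_finiteDimensional _
  have hcomp := (isCompact_sphere (0 : Fin n → ℝ) 1).inter_right hcl
  obtain ⟨z, ⟨hz1, pz, hpz⟩, φ, hφ, hlim⟩ := hcomp.tendsto_subseq
    (x := u) (fun N => ⟨by simp [hun N], hur N⟩)
  have hz0 : z ≠ 0 := by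
    rintro rfl; simp at hz1
  have hv : Tendsto (fun N => (a N)⁻¹ • v N) atTop (𝓝 0) := by
    rw [tendsto_zero_iff_norm_tendsto_zero]
    refine squeeze_zero (fun _ => norm_nonneg _) (fun N => ?_) tendsto_one_div_add_atTop_nhds_zero_nat
    rw [norm_smul, norm_inv, Real.norm_eq_abs, abs_of_pos (hapos N), inv_mul_le_iff₀ (hapos N)]
    have := hlt N
    rw [mul_one_div, le_div_iff₀ (by positivity)]
    have h3 : ((N : ℝ) + 1) * ‖v N‖ < a N := this
    linarith
  have hdiff : Tendsto (fun k => u (φ k) - (a (φ k))⁻¹ • v (φ k)) atTop (𝓝 z) := by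
    have := hlim.sub (hv.comp hφ.tendsto_atTop)
    simpa using this
  have hev : ∀ᶠ k in atTop, ∀ i, z i ≠ 0 →
      0 < z i * (u (φ k) i - (a (φ k))⁻¹ * v (φ k) i) := by
    rw [eventually_all]
    intro i
    by_cases hi : z i = 0
    · simp [hi]
    have h1 := ((tendsto_pi_nhds.1 hdiff) i).const_mul (z i)
    have h2 : 0 < z i * z i := mul_self_pos.2 hi
    filter_upwards [h1.eventually (lt_mem_nhds h2)] with k hk _
    simpa using hk
  obtain ⟨k, hk⟩ := hev.exists
  have hsum : ∑ i, w (φ k) i * (z i * (u (φ k) i - (a (φ k))⁻¹ * v (φ k) i)) = 0 := by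
    have h2 : pz ⬝ᵥ (B *ᵥ (fun i => w (φ k) i * ((Bᵀ *ᵥ p (φ k)) i - v (φ k) i))) = 0 := by
      rw [h0]; simp
    rw [Matrix.dotProduct_mulVec, ← Matrix.mulVec_transpose] at h2
    have hpz' : Bᵀ *ᵥ pz = z := hpz
    rw [hpz', dotProduct] at h2
    rw [← mul_zero (a (φ k))⁻¹, ← h2, Finset.mul_sum]
    refine Finset.sum_congr rfl fun i _ => ?_
    simp only [hu, Pi.smul_apply, smul_eq_mul]
    ring
  have hnn : ∀ i ∈ Finset.univ, 0 ≤ w (φ k) i * (z i * (u (φ k) i - (a (φ k))⁻¹ * v (φ k) i)) := by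
    intro i _
    by_cases hi : z i = 0
    · simp [hi]
    · exact mul_nonneg (hw _ i).le (hk i hi).le
  rw [Finset.sum_eq_zero_iff_of_nonneg hnn] at hsum
  apply hz0
  ext i
  by_contra hi
  exact (mul_pos (hw _ i) (hk i hi)).ne' (hsum i (Finset.mem_univ i))

/-- Bounds on the potential differences and on `q`. -/
lemma phys_bounds {m n : ℕ} {B : Matrix (Fin m) (Fin n) ℝ} (hB : B.rank = m)
    {b : Fin m → ℝ} {y : Fin n → ℝ} (hy : B *ᵥ y = b) :
    ∃ K : ℝ, 0 ≤ K ∧ ∀ w : Fin n → ℝ, (∀ i, 0 < w i) → ∀ i,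
      |(Bᵀ *ᵥ ((B * Matrix.diagonal w * Bᵀ)⁻¹ *ᵥ b)) i| ≤ K * ‖fun j => y j / w j‖ ∧
      |w i * (Bᵀ *ᵥ ((B * Matrix.diagonal w * Bᵀ)⁻¹ *ᵥ b)) i| ≤ K := by
  obtain ⟨K, hK⟩ := phys_dst B
  have key : ∀ w : Fin n → ℝ, (∀ i, 0 < w i) → ∀ v : Fin n → ℝ, 
      ‖Bᵀ *ᵥ ((B * Matrix.diagonal w * Bᵀ)⁻¹ *ᵥ (B *ᵥ (fun i => w i * v i)))‖ ≤ K * ‖v‖ := by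
    intro w hw v
    apply hK _ _ w hw
    have : (fun i => w i * ((Bᵀ *ᵥ ((B * Matrix.diagonal w * Bᵀ)⁻¹ *ᵥ (B *ᵥ (fun i => w i * v i)))) i - v i))
      = Matrix.diagonal w *ᵥ (Bᵀ *ᵥ ((B * Matrix.diagonal w * Bᵀ)⁻¹ *ᵥ (B *ᵥ (fun i => w i * v i))))
        - fun i => w i * v i := by
      rw [phys_diag_mulVec]; ext i; simp; ring
    rw [this, Matrix.mulVec_sub, Matrix.mulVec_mulVec, Matrix.mulVec_mulVec, Matrix.mulVec_mulVec,
      Matrix.mul_nonsing_inv _ (phys_unit hB hw), Matrix.one_mulVec, sub_self]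
  have hsymm : ∀ (w : Fin n → ℝ) (f g : Fin n → ℝ),
      f ⬝ᵥ (Bᵀ *ᵥ ((B * Matrix.diagonal w * Bᵀ)⁻¹ *ᵥ (B *ᵥ g))) =
      (Bᵀ *ᵥ ((B * Matrix.diagonal w * Bᵀ)⁻¹ *ᵥ (B *ᵥ f))) ⬝ᵥ g := by
    intro w f g
    have h1 : (Bᵀ * ((B * Matrix.diagonal w * Bᵀ)⁻¹ * B))ᵀ = Bᵀ * ((B * Matrix.diagonal w * Bᵀ)⁻¹ * B) := by
      simp [Matrix.transpose_mul, Matrix.transpose_nonsing_inv, Matrix.mul_assoc]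
    rw [Matrix.mulVec_mulVec, Matrix.mulVec_mulVec, Matrix.mulVec_mulVec, Matrix.mulVec_mulVec,
      Matrix.dotProduct_mulVec, ← Matrix.mulVec_transpose]
    simp only [Matrix.mul_assoc] at h1 ⊢
    rw [h1]
  refine ⟨|K| + ∑ j, |K| * |y j|, by positivity, fun w hw i => ⟨?_, ?_⟩⟩
  · have h1 := key w hw (fun j => y j / w j)
    have h2 : (fun i => w i * (y i / w i)) = y := by
      ext i; field_simp [(hw i).ne']
    rw [h2, hy] at h1
    have h3 := norm_le_pi_norm (Bᵀ *ᵥ ((B * Matrix.diagonal w * Bᵀ)⁻¹ *ᵥ b)) i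
    rw [Real.norm_eq_abs] at h3
    refine h3.trans (h1.trans ?_)
    gcongr
    have : 0 ≤ ∑ j, |K| * |y j| := by positivity
    linarith [le_abs_self K]
  · have h1 := key w hw (Pi.single i 1)
    have h2 : (fun j => w j * (Pi.single i 1 : Fin n → ℝ) j) = Pi.single i (w i) := by
      ext j; by_cases h : j = i
      · subst h; simp
      · simp [h]
    rw [h2] at h1
    have h3 := hsymm w (Pi.single i (w i)) y
    rw [hy, single_dotProduct] at h3
    rw [h3, dotProduct]
    refine (Finset.abs_sum_le_sum_abs _ _).trans ?_
    have : ∑ j, |(Bᵀ *ᵥ ((B * Matrix.diagonal w * Bᵀ)⁻¹ *ᵥ (B *ᵥ (Pi.single i (w i))))) j * y j| ≤ ∑ j, |K| * |y j| := by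
      refine Finset.sum_le_sum fun j _ => ?_
      rw [abs_mul]
      refine mul_le_mul_of_nonneg_right ?_ (abs_nonneg _)
      have h4 := norm_le_pi_norm (Bᵀ *ᵥ ((B * Matrix.diagonal w * Bᵀ)⁻¹ *ᵥ (B *ᵥ (Pi.single i (w i))))) j
      rw [Real.norm_eq_abs] at h4
      refine h4.trans (h1.trans ?_)
      rw [Pi.norm_single]; simp [le_abs_self]
    linarith [abs_nonneg K]

lemma phys_energy {m n : ℕ} {B : Matrix (Fin m) (Fin n) ℝ} (hB : B.rank = m)
    {b : Fin m → ℝ} {y : Fin n → ℝ} (hy : B *ᵥ y = b) {w : Fin n → ℝ} (hw : ∀ i, 0 < w i) :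
    0 ≤ ∑ i, y i * (Bᵀ *ᵥ ((B * Matrix.diagonal w * Bᵀ)⁻¹ *ᵥ b)) i := by
  set p := (B * Matrix.diagonal w * Bᵀ)⁻¹ *ᵥ b with hp
  have h1 : B *ᵥ (fun i => w i * (Bᵀ *ᵥ p) i) = b := by
    rw [← phys_diag_mulVec, hp, Matrix.mulVec_mulVec, Matrix.mulVec_mulVec, Matrix.mulVec_mulVec,
      Matrix.mul_nonsing_inv _ (phys_unit hB hw), Matrix.one_mulVec]
  have h2 : ∀ f : Fin n → ℝ, ∑ i, f i * (Bᵀ *ᵥ p) i = (B *ᵥ f) ⬝ᵥ p := by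
    intro f
    rw [dotProduct_comm (B *ᵥ f), Matrix.dotProduct_mulVec, ← Matrix.mulVec_transpose, dotProduct_comm]
    rfl
  rw [h2, hy, ← h1, ← h2]
  exact Finset.sum_nonneg fun i _ => by
    have := hw i
    have h3 := mul_self_nonneg ((Bᵀ *ᵥ p) i)
    nlinarith [mul_nonneg this.le h3]

lemma phys_det_contDiff {n k : ℕ} {M : (Fin n → ℝ) → Matrix (Fin k) (Fin k) ℝ}
    (hM : ∀ i j, ContDiff ℝ 1 (fun x => M x i j)) : ContDiff ℝ 1 (fun x => (M x).det) := by
  simp only [Matrix.det_apply]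
  refine ContDiff.sum fun σ _ => ?_
  refine ContDiff.const_smul _ ?_
  exact contDiff_prod fun i _ => hM _ _

lemma phys_contDiffOn {m n : ℕ} {B : Matrix (Fin m) (Fin n) ℝ} (hB : B.rank = m)
    (b : Fin m → ℝ) {c : Fin n → ℝ} (hc : ∀ i, 0 < c i) :
    ContDiffOn ℝ 1 (fun x => physQ B b c x - x) {x | ∀ i, 0 < x i} := by
  refine ContDiffOn.sub ?_ contDiffOn_id
  have hw : ∀ i : Fin n, ContDiff ℝ 1 (fun x : Fin n → ℝ => x i / c i) := by
    intro i
    exact (contDiff_apply ℝ ℝ i).div_const _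
  have hL : ∀ i j, ContDiff ℝ 1 (fun x : Fin n → ℝ => (B * physW c x * Bᵀ) i j) := by
    intro i j
    have h : ∀ x : Fin n → ℝ, (B * physW c x * Bᵀ) i j = ∑ k, B i k * (x k / c k) * Bᵀ k j := by
      intro x
      rw [physW, Matrix.mul_apply]
      simp only [Matrix.mul_diagonal]
    simp only [h]
    refine ContDiff.sum fun k _ => ?_
    exact (contDiff_const.mul (hw k)).mul contDiff_const
  have hdet := phys_det_contDiff hL
  have hadj : ∀ i j, ContDiff ℝ 1 (fun x : Fin n → ℝ => (B * physW c x * Bᵀ).adjugate i j) := by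
    intro i j
    simp only [Matrix.adjugate_apply]
    apply phys_det_contDiff
    intro k l
    by_cases hk : k = j
    · subst hk
      simp only [Matrix.updateRow_self]
      exact contDiff_const
    · simp only [Matrix.updateRow_ne hk]
      exact hL k l
  have hinv : ∀ i j, ContDiffOn ℝ 1 (fun x : Fin n → ℝ => (B * physW c x * Bᵀ)⁻¹ i j)
      {x | ∀ i, 0 < x i} := by
    intro i j
    simp only [Matrix.inv_def, Ring.inverse_eq_inv', Matrix.smul_apply, smul_eq_mul]
    refine ContDiffOn.mul (hdet.contDiffOn.inv ?_) (hadj i j).contDiffOn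
    intro x hx
    exact (phys_unit hB (w := fun i => x i / c i) (fun i => div_pos (hx i) (hc i))).ne_zero
  rw [contDiffOn_pi]
  intro i
  simp only [physQ]
  simp only [physW, phys_diag_mulVec]
  refine (hw i).contDiffOn.mul ?_
  simp only [Matrix.mulVec, dotProduct]
  refine ContDiffOn.sum fun j _ => contDiffOn_const.mul ?_
  refine ContDiffOn.sum fun k _ => ContDiffOn.mul ?_ contDiffOn_const
  exact hinv j k

lemma phys_mono {T : ℝ} {f f' : ℝ → ℝ}
    (hf : ∀ t ∈ Icc 0 T, HasDerivWithinAt f (f' t) (Icc 0 T) t)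
    (hf' : ∀ t ∈ Icc 0 T, 0 ≤ f' t) {t : ℝ} (ht : t ∈ Icc 0 T) : f 0 ≤ f t := by
  have h : MonotoneOn f (Icc 0 T) := by
    refine monotoneOn_of_hasDerivWithinAt_nonneg (f' := f') (convex_Icc 0 T)
      (fun t ht => (hf t ht).continuousWithinAt) ?_ ?_
    · intro x hx
      exact (hf x (interior_subset hx)).mono interior_subset
    · intro x hx
      exact hf' x (interior_subset hx)
  exact h ⟨le_rfl, ht.1.trans ht.2⟩ ht ht.1

lemma phys_apriori {m n : ℕ} {B : Matrix (Fin m) (Fin n) ℝ} (hB : B.rank = m)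
    {b : Fin m → ℝ} {c : Fin n → ℝ} (hc : ∀ i, 0 < c i) {y : Fin n → ℝ} (hy : B *ᵥ y = b)
    (hy0 : ∀ i, 0 ≤ y i) {s : Fin n → ℝ} (hs : ∀ i, 0 < s i) (T : ℝ) :
    ∃ δ M : ℝ, 0 < δ ∧ ∀ T' ≤ T, ∀ x : ℝ → Fin n → ℝ, x 0 = s →
      IsPhysSolOn B b c x (Icc 0 T') → ∀ t ∈ Icc 0 T', ∀ i, δ ≤ x t i ∧ x t i ≤ M := by
  obtain ⟨K, hK0, hK⟩ := phys_bounds hB hy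
  set M : ℝ := 1 + K + ‖s‖ with hM
  have hM1 : 1 ≤ M := by have := norm_nonneg s; linarith
  set V0 : ℝ := ∑ i, c i * y i * Real.log (s i)
  set D : ℝ := ∑ i, c i * y i
  have hcy : ∀ i, 0 ≤ c i * y i := fun i => mul_nonneg (hc i).le (hy0 i)
  set S : ℝ := |V0| + D * |T| + D * Real.log M with hS
  set R : ℝ := ∑ i, y i * c i * Real.exp (S / (c i * y i)) with hR
  set C : ℝ := ∑ i, (K * R) / c i + 1 with hC
  have hRt : ∀ i, 0 ≤ y i * c i * Real.exp (S / (c i * y i)) := fun i =>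
    mul_nonneg (mul_nonneg (hy0 i) (hc i).le) (Real.exp_pos _).le
  have hR0 : 0 ≤ R := Finset.sum_nonneg fun i _ => hRt i
  have hC0 : 0 ≤ C := by
    have : 0 ≤ ∑ i, (K * R) / c i := Finset.sum_nonneg fun i _ => 
      div_nonneg (mul_nonneg hK0 hR0) (hc i).le
    linarith
  obtain ⟨δ0, hδ0, hδs⟩ : ∃ δ0 : ℝ, 0 < δ0 ∧ ∀ i, δ0 ≤ s i := by
    rcases isEmpty_or_nonempty (Fin n) with h | h
    · exact ⟨1, one_pos, fun i => h.elim i⟩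
    · obtain ⟨i, hi⟩ := Finite.exists_min s
      exact ⟨s i, hs i, hi⟩
  refine ⟨δ0 * Real.exp (-(C * |T|)), M, by positivity, ?_⟩
  intro T' hT' x hx0 hx
  set g : ℝ → Fin n → ℝ := fun t =>
    Bᵀ *ᵥ ((B * Matrix.diagonal (fun i => x t i / c i) * Bᵀ)⁻¹ *ᵥ b) with hg
  have hpos : ∀ t ∈ Icc 0 T', ∀ i, 0 < x t i := fun t ht => (hx t ht).1
  have hwpos : ∀ t ∈ Icc 0 T', ∀ i, 0 < x t i / c i := fun t ht i => div_pos (hpos t ht i) (hc i)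
  have hder : ∀ t ∈ Icc 0 T', ∀ i,
      HasDerivWithinAt (fun t => x t i) (x t i / c i * g t i - x t i) (Icc 0 T') t := by
    intro t ht i
    have := (hasDerivWithinAt_pi.1 (hx t ht).2) i
    simpa only [physQ, physW, phys_diag_mulVec, Pi.sub_apply] using this
  have hTt : ∀ t ∈ Icc 0 T', t ≤ |T| := fun t ht => (ht.2.trans hT').trans (le_abs_self T)
  -- upper bound
  have hup : ∀ t ∈ Icc 0 T', ∀ i, x t i ≤ M := by
    intro t ht i
    have h1 := phys_mono (T := T') (f := fun t => Real.exp t * (K - x t i))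
      (f' := fun t => Real.exp t * (K - x t i) + Real.exp t * (0 - (x t i / c i * g t i - x t i)))
      (fun t ht => ((Real.hasDerivAt_exp t).hasDerivWithinAt).mul
        ((hasDerivWithinAt_const t _ K).sub (hder t ht i)))
      (fun t ht => by
        have h2 := (hK _ (hwpos t ht) i).2
        have h3 := (abs_le.1 h2).2
        have : 0 ≤ Real.exp t * (K - x t i / c i * g t i) :=
          mul_nonneg (Real.exp_pos t).le (sub_nonneg.2 h3)
        linarith) ht
    simp only [Real.exp_zero, one_mul, hx0] at h1
    have h2 : 1 ≤ Real.exp t := Real.one_le_exp ht.1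
    have h3 : s i ≤ ‖s‖ := (le_abs_self _).trans (norm_le_pi_norm s i)
    by_contra! h4
    have h5 := norm_nonneg s
    nlinarith
  -- Lyapunov function
  have hV : ∀ t ∈ Icc 0 T', V0 - D * t ≤ ∑ i, c i * y i * Real.log (x t i) := by
    intro t ht
    have h1 := phys_mono (T := T') (f := fun t => ∑ i, c i * y i * Real.log (x t i) + D * t)
      (f' := fun t => ∑ i, c i * y i * ((x t i / c i * g t i - x t i) / x t i) + D * 1)
      (fun t ht => by
        refine HasDerivWithinAt.add ?_ ((hasDerivWithinAt_id t _).const_mul D)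
        refine HasDerivWithinAt.fun_sum fun i _ => ?_
        exact ((hder t ht i).log (hpos t ht i).ne').const_mul _)
      (fun t ht => by
        have h2 : ∑ i, c i * y i * ((x t i / c i * g t i - x t i) / x t i) + D * 1
            = ∑ i, y i * g t i := by
          rw [mul_one, ← Finset.sum_add_distrib]
          refine Finset.sum_congr rfl fun i _ => ?_
          have := (hpos t ht i).ne'
          have := (hc i).ne'
          field_simp
          ring
        rw [h2]
        exact phys_energy hB hy (hwpos t ht)) ht
    simp only [hx0, mul_zero, add_zero] at h1
    change V0 ≤ _ at h1
    linarith
  have hlogM : 0 ≤ Real.log M := Real.log_nonneg hM1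
  have hD0 : 0 ≤ D := Finset.sum_nonneg fun i _ => hcy i
  have hsup : ∀ t ∈ Icc 0 T', ‖fun j => y j / (x t j / c j)‖ ≤ R := by
    intro t ht
    rw [pi_norm_le_iff_of_nonneg hR0]
    intro i
    have hnn : 0 ≤ y i / (x t i / c i) := div_nonneg (hy0 i) (hwpos t ht i).le
    rw [Real.norm_eq_abs, abs_of_nonneg hnn]
    refine le_trans ?_ (Finset.single_le_sum (fun i _ => hRt i) (Finset.mem_univ i))
    rcases (hy0 i).eq_or_lt with h | h
    · simp [← h]
    have hcyi : 0 < c i * y i := mul_pos (hc i) h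
    have h1 : ∑ j, c j * y j * Real.log (x t j) ≤ c i * y i * Real.log (x t i) + D * Real.log M := by
      have h2 : ∑ j, c j * y j * Real.log (x t j) - D * Real.log M
          = ∑ j, c j * y j * (Real.log (x t j) - Real.log M) := by
        simp only [mul_sub, Finset.sum_sub_distrib, D, Finset.sum_mul]
      have h3 : ∀ j ∈ Finset.univ, 0 ≤ c j * y j * (Real.log M - Real.log (x t j)) := fun j _ =>
        mul_nonneg (hcy j) (sub_nonneg.2 (Real.log_le_log (hpos t ht j) (hup t ht j)))
      have h4 := Finset.single_le_sum h3 (Finset.mem_univ i)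
      have h5 : ∑ j, c j * y j * (Real.log (x t j) - Real.log M)
          = - ∑ j, c j * y j * (Real.log M - Real.log (x t j)) := by
        rw [← Finset.sum_neg_distrib]
        exact Finset.sum_congr rfl fun j _ => by ring
      have h6 : 0 ≤ c i * y i * Real.log M := mul_nonneg (hcy i) hlogM
      linarith
    have h2 : -S ≤ c i * y i * Real.log (x t i) := by
      have h3 := hV t ht
      have h4 := neg_abs_le V0
      have h5 : D * t ≤ D * |T| := mul_le_mul_of_nonneg_left (hTt t ht) hD0
      linarith
    have h3 : - Real.log (x t i) ≤ S / (c i * y i) := by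
      rw [le_div_iff₀ hcyi]; linarith
    have h4 : (x t i)⁻¹ ≤ Real.exp (S / (c i * y i)) := by
      rw [← Real.exp_log (inv_pos.2 (hpos t ht i)), Real.log_inv]
      exact Real.exp_le_exp.2 h3
    have h5 : y i / (x t i / c i) = y i * c i * (x t i)⁻¹ := by
      rw [div_div_eq_mul_div, div_eq_mul_inv]
    rw [h5]
    exact mul_le_mul_of_nonneg_left h4 (mul_nonneg (hy0 i) (hc i).le)
  intro t ht i
  refine ⟨?_, hup t ht i⟩
  have hgb : ∀ t ∈ Icc 0 T', 0 ≤ C + (g t i / c i - 1) := by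
    intro t ht
    have h1 := (hK _ (hwpos t ht) i).1
    have h2 : |g t i| ≤ K * R := h1.trans (mul_le_mul_of_nonneg_left (hsup t ht) hK0)
    have h3 : -(K * R) / c i ≤ g t i / c i := by
      have := (abs_le.1 h2).1
      exact div_le_div_of_nonneg_right this (hc i).le
    have h4 : K * R / c i ≤ ∑ i, K * R / c i :=
      Finset.single_le_sum (f := fun i => K * R / c i)
        (fun i _ => div_nonneg (mul_nonneg hK0 hR0) (hc i).le) (Finset.mem_univ i)
    rw [neg_div] at h3
    linarith
  have h1 := phys_mono (T := T') (f := fun t => Real.exp (C * t) * x t i)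
    (f' := fun t => Real.exp (C * t) * (C * 1) * x t i
      + Real.exp (C * t) * (x t i / c i * g t i - x t i))
    (fun t ht => (((hasDerivWithinAt_id t _).const_mul C).exp).mul (hder t ht i))
    (fun t ht => by
      have h2 : Real.exp (C * t) * (C * 1) * x t i
          + Real.exp (C * t) * (x t i / c i * g t i - x t i)
          = Real.exp (C * t) * (x t i * (C + (g t i / c i - 1))) := by ring
      rw [h2]
      exact mul_nonneg (Real.exp_pos _).le (mul_nonneg (hpos t ht i).le (hgb t ht))) ht
  simp only [mul_zero, Real.exp_zero, one_mul, hx0] at h1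
  have h2 : Real.exp (-(C * |T|)) * (Real.exp (C * t) * x t i) ≤ x t i := by
    rw [← mul_assoc, ← Real.exp_add]
    have : Real.exp (-(C * |T|) + C * t) ≤ 1 := by
      rw [Real.exp_le_one_iff]
      have := mul_le_mul_of_nonneg_left (hTt t ht) hC0
      linarith
    nlinarith [hpos t ht i]
  calc δ0 * Real.exp (-(C * |T|)) ≤ s i * Real.exp (-(C * |T|)) :=
        mul_le_mul_of_nonneg_right (hδs i) (Real.exp_pos _).le
    _ ≤ (Real.exp (C * t) * x t i) * Real.exp (-(C * |T|)) :=
        mul_le_mul_of_nonneg_right h1 (Real.exp_pos _).le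
    _ ≤ x t i := by rw [mul_comm]; exact h2

lemma phys_sol_mono {m n : ℕ} {B : Matrix (Fin m) (Fin n) ℝ} {b : Fin m → ℝ}
    {c : Fin n → ℝ} {x : ℝ → Fin n → ℝ} {s s' : Set ℝ} (h : IsPhysSolOn B b c x s)
    (hs : s' ⊆ s) : IsPhysSolOn B b c x s' :=
  fun t ht => ⟨(h t (hs ht)).1, (h t (hs ht)).2.mono hs⟩

lemma phys_box {m n : ℕ} {B : Matrix (Fin m) (Fin n) ℝ} (hB : B.rank = m)
    (b : Fin m → ℝ) {c : Fin n → ℝ} (hc : ∀ i, 0 < c i) {δ : ℝ} (hδ : 0 < δ) (M : ℝ) :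
    ∃ K, LipschitzOnWith K (fun x => physQ B b c x - x)
      (Icc (fun _ => δ) (fun _ => M) : Set (Fin n → ℝ)) := by
  refine ContDiffOn.exists_lipschitzOnWith (n := 1) ((phys_contDiffOn hB b hc).mono ?_) one_ne_zero
    (convex_Icc _ _) isCompact_Icc
  intro x hx i
  exact hδ.trans_le (hx.1 i)

lemma phys_unique {m n : ℕ} {B : Matrix (Fin m) (Fin n) ℝ} (hB : B.rank = m)
    {b : Fin m → ℝ} {c : Fin n → ℝ} (hc : ∀ i, 0 < c i) {y : Fin n → ℝ} (hy : B *ᵥ y = b)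
    (hy0 : ∀ i, 0 ≤ y i) {s : Fin n → ℝ} (hs : ∀ i, 0 < s i) {T : ℝ} {x z : ℝ → Fin n → ℝ}
    (hx0 : x 0 = s) (hz0 : z 0 = s) (hx : IsPhysSolOn B b c x (Icc 0 T))
    (hz : IsPhysSolOn B b c z (Icc 0 T)) : EqOn x z (Icc 0 T) := by
  obtain ⟨δ, M, hδ, hap⟩ := phys_apriori hB hc hy hy0 hs T
  obtain ⟨K, hK⟩ := phys_box hB b hc hδ M
  have hd : ∀ {x : ℝ → Fin n → ℝ}, IsPhysSolOn B b c x (Icc 0 T) → ∀ t ∈ Ico 0 T,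
      HasDerivWithinAt x (physQ B b c (x t) - x t) (Ici t) t := fun {x} hx t ht =>
    (hx t (Ico_subset_Icc_self ht)).2.mono_of_mem_nhdsWithin (Icc_mem_nhdsGE_of_mem ht)
  have hm : ∀ {x : ℝ → Fin n → ℝ}, x 0 = s → IsPhysSolOn B b c x (Icc 0 T) → ∀ t ∈ Ico 0 T,
      x t ∈ (Icc (fun _ => δ) (fun _ => M) : Set (Fin n → ℝ)) := fun {x} hx0 hx t ht =>
    ⟨fun i => (hap T le_rfl x hx0 hx t (Ico_subset_Icc_self ht) i).1,
      fun i => (hap T le_rfl x hx0 hx t (Ico_subset_Icc_self ht) i).2⟩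
  exact ODE_solution_unique_of_mem_Icc_right (v := fun _ x => physQ B b c x - x)
    (s := fun _ => (Icc (fun _ => δ) (fun _ => M) : Set (Fin n → ℝ)))
    (fun _ _ => hK) (fun t ht => (hx t ht).2.continuousWithinAt) (hd hx) (hm hx0 hx)
    (fun t ht => (hz t ht).2.continuousWithinAt) (hd hz) (hm hz0 hz) (hx0.trans hz0.symm)

lemma phys_exists {m n : ℕ} {B : Matrix (Fin m) (Fin n) ℝ} (hB : B.rank = m)
    {b : Fin m → ℝ} {c : Fin n → ℝ} (hc : ∀ i, 0 < c i) {y : Fin n → ℝ} (hy : B *ᵥ y = b)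
    (hy0 : ∀ i, 0 ≤ y i) {s : Fin n → ℝ} (hs : ∀ i, 0 < s i) {T : ℝ} (hT : 0 ≤ T) :
    ∃ x : ℝ → Fin n → ℝ, x 0 = s ∧ IsPhysSolOn B b c x (Icc 0 T) := by
  obtain ⟨δ, M', hδ, hap'⟩ := phys_apriori hB hc hy hy0 hs T
  obtain ⟨M, hMδ, hap⟩ : ∃ M, δ ≤ M ∧ ∀ T' ≤ T, ∀ x : ℝ → Fin n → ℝ, x 0 = s →
      IsPhysSolOn B b c x (Icc 0 T') → ∀ t ∈ Icc 0 T', ∀ i, δ ≤ x t i ∧ x t i ≤ M :=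
    ⟨max M' δ, le_max_right _ _, fun T' h x h0 hx t ht i =>
      ⟨(hap' T' h x h0 hx t ht i).1, (hap' T' h x h0 hx t ht i).2.trans (le_max_left _ _)⟩⟩
  obtain ⟨K, hK⟩ := phys_box hB b hc (half_pos hδ) (M + 1)
  set Wd : Set (Fin n → ℝ) := Icc (fun _ => δ / 2) (fun _ => M + 1) with hWd
  have hsbox : ∀ i, δ ≤ s i ∧ s i ≤ M := by
    refine hap 0 hT (fun _ => s) rfl ?_ 0 ⟨le_rfl, le_rfl⟩
    intro t ht
    refine ⟨hs, ?_⟩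
    rw [Icc_self] at ht ⊢
    rw [mem_singleton_iff] at ht
    subst ht
    exact HasFDerivWithinAt.of_subsingleton subsingleton_singleton
  set cl : (Fin n → ℝ) → (Fin n → ℝ) := fun x i => max (δ / 2) (min (x i) (M + 1)) with hcl
  have hclL : LipschitzWith 1 cl := by
    refine LipschitzWith.of_dist_le_mul fun x z => ?_
    rw [NNReal.coe_one, one_mul, dist_pi_le_iff dist_nonneg]
    intro i
    have h1 : LipschitzWith 1 (fun r : ℝ => max (δ / 2) (min r (M + 1))) :=
      (LipschitzWith.id.min_const (M + 1)).const_max (δ / 2)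
    have h2 := h1.dist_le_mul (x i) (z i)
    rw [NNReal.coe_one, one_mul] at h2
    exact h2.trans (dist_le_pi_dist x z i)
  have hclm : ∀ x, cl x ∈ Wd := fun x =>
    ⟨fun i => le_max_left _ _, fun i => max_le (by linarith) (min_le_right _ _)⟩
  have hclid : ∀ x ∈ Wd, cl x = x := by
    intro x hx
    ext i
    simp only [hcl]
    rw [min_eq_left (hx.2 i), max_eq_right (hx.1 i)]
  set F : (Fin n → ℝ) → (Fin n → ℝ) := fun x => physQ B b c (cl x) - cl x with hF
  have hFL : LipschitzOnWith (K * 1) F univ :=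
    hK.comp (hclL.lipschitzOnWith (s := univ)) (fun x _ => hclm x)
  obtain ⟨L0, hL0⟩ := (isCompact_Icc (a := fun _ : Fin n => δ / 2) (b := fun _ => M + 1)).exists_bound_of_continuousOn
    hK.continuousOn
  set L : NNReal := L0.toNNReal with hL
  have hFb : ∀ x, ‖F x‖ ≤ L := fun x => (hL0 _ (hclm x)).trans (Real.le_coe_toNNReal _)
  have hPL : IsPicardLindelof (fun _ => F) (tmin := 0) (tmax := T) ⟨0, le_rfl, hT⟩ s
      (L * T.toNNReal) 0 L (K * 1) := by
    refine ⟨fun t _ => hFL.mono (subset_univ _), fun x _ => continuousOn_const,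
      fun t _ x _ => hFb x, ?_⟩
    simp [hT]
  obtain ⟨x, hx0, hx⟩ := hPL.exists_eq_forall_mem_Icc_hasDerivWithinAt₀
  replace hx0 : x 0 = s := hx0
  have hxc : ContinuousOn x (Icc 0 T) := fun t ht => (hx t ht).continuousWithinAt
  have hsol : ∀ u ≤ T, (∀ t ∈ Icc 0 u, x t ∈ Wd) → IsPhysSolOn B b c x (Icc 0 u) := by
    intro u hu h t ht
    refine ⟨fun i => (half_pos hδ).trans_le ((h t ht).1 i), ?_⟩
    have h1 := (hx t ⟨ht.1, ht.2.trans hu⟩).mono (Icc_subset_Icc_right hu)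
    simp only [hF, hclid _ (h t ht)] at h1
    exact h1
  set Tt : Set (Fin n → ℝ) := Icc (fun _ => δ) (fun _ => M) with hTt
  have hTW : Tt ⊆ Wd := fun x hx =>
    ⟨fun i => by have := hx.1 i; simp only at this ⊢; linarith,
     fun i => by have := hx.2 i; simp only at this ⊢; linarith⟩
  have hind : Icc 0 T ⊆ x ⁻¹' Tt := by
    apply IsClosed.Icc_subset_of_forall_mem_nhdsGT_of_Icc_subset
    · rw [inter_comm]
      exact hxc.preimage_isClosed_of_isClosed isClosed_Icc isClosed_Icc
    · change x 0 ∈ Tt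
      rw [hx0]
      exact ⟨fun i => (hsbox i).1, fun i => (hsbox i).2⟩
    · intro t ht hsub
      have hxt : x t ∈ Tt := hsub ⟨ht.1, le_rfl⟩
      have hnb : Wd ∈ 𝓝 (x t) := by
        rw [hWd, ← pi_univ_Icc]
        refine set_pi_mem_nhds finite_univ fun i _ => Icc_mem_nhds ?_ ?_
        · have := hxt.1 i; simp only at this; linarith
        · have := hxt.2 i; simp only at this; linarith
      have h1 : x ⁻¹' Wd ∈ 𝓝[≥] t :=
        ((hxc t (Ico_subset_Icc_self ht)).mono_of_mem_nhdsWithin (Icc_mem_nhdsGE_of_mem ht)) hnb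
      obtain ⟨u, hu, hus⟩ := (mem_nhdsGE_iff_exists_Icc_subset).1 h1
      have hu' : t < min u T := lt_min hu ht.2
      have h2 : ∀ r ∈ Icc 0 (min u T), x r ∈ Wd := by
        intro r hr
        rcases le_total r t with h | h
        · exact hTW (hsub ⟨hr.1, h⟩)
        · exact hus ⟨h, hr.2.trans (min_le_left _ _)⟩
      have h3 := hap _ (min_le_right u T) x hx0 (hsol _ (min_le_right _ _) h2)
      refine mem_of_superset (Ioc_mem_nhdsGT hu') fun r hr => ?_
      have hr' : r ∈ Icc 0 (min u T) := ⟨ht.1.trans hr.1.le, hr.2⟩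
      exact ⟨fun i => (h3 r hr' i).1, fun i => (h3 r hr' i).2⟩
  exact ⟨x, hx0, hsol T le_rfl fun t ht => hTW (hind ht)⟩


theorem physarum_global_existence_uniqueness {m n : ℕ} (A : Matrix (Fin m) (Fin n) ℤ)
    (hrank : (rmat A).rank = m)
    (b : Fin m → ℤ) (c : Fin n → ℤ) (hc : ∀ i, 0 < c i)
    (hfeas : ∃ y : Fin n → ℝ, (rmat A *ᵥ y = fun j => (b j : ℝ)) ∧ ∀ i, 0 ≤ y i)
    (s : Fin n → ℝ) (hs : ∀ i, 0 < s i) :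
    ∃ x : ℝ → Fin n → ℝ,
      (x 0 = s ∧
        IsPhysSolOn (rmat A) (fun j => (b j : ℝ)) (fun i => (c i : ℝ)) x (Set.Ici 0)) ∧
      ∀ y : ℝ → Fin n → ℝ,
        (y 0 = s ∧
          IsPhysSolOn (rmat A) (fun j => (b j : ℝ)) (fun i => (c i : ℝ)) y (Set.Ici 0)) →
        Set.EqOn y x (Set.Ici 0) := by
  obtain ⟨y, hy, hy0⟩ := hfeas
  have hc' : ∀ i, 0 < (c i : ℝ) := fun i => Int.cast_pos.2 (hc i)
  choose X hX0 hX using fun N : ℕ => phys_exists hrank hc' hy hy0 hs (Nat.cast_nonneg (α := ℝ) N)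
  set x : ℝ → Fin n → ℝ := fun t => X (⌊t⌋₊ + 1) t with hxdef
  have hag : ∀ N : ℕ, ∀ t ∈ Icc (0 : ℝ) N, x t = X N t := by
    intro N t ht
    have h1 : t ≤ ((⌊t⌋₊ + 1 : ℕ) : ℝ) := by
      push_cast; exact (Nat.lt_floor_add_one t).le
    exact phys_unique hrank hc' hy hy0 hs (hX0 _) (hX0 _)
      (phys_sol_mono (hX (⌊t⌋₊ + 1)) (Icc_subset_Icc_right h1))
      (phys_sol_mono (hX N) (Icc_subset_Icc_right ht.2)) ⟨ht.1, le_rfl⟩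
  have hx0 : x 0 = s := hX0 _
  have hxs : IsPhysSolOn (rmat A) (fun j => (b j : ℝ)) (fun i => (c i : ℝ)) x (Set.Ici 0) := by
    intro t ht
    have ht0 : 0 ≤ t := ht
    have h1 : t < ((⌊t⌋₊ + 1 : ℕ) : ℝ) := by
      push_cast; exact Nat.lt_floor_add_one t
    have hmem : t ∈ Icc (0 : ℝ) ((⌊t⌋₊ + 1 : ℕ) : ℝ) := ⟨ht0, h1.le⟩
    have h2 := hX (⌊t⌋₊ + 1) t hmem
    have hnb : Icc (0 : ℝ) ((⌊t⌋₊ + 1 : ℕ) : ℝ) ∈ 𝓝[Ici 0] t := by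
      rw [← Ici_inter_Iic]
      exact inter_mem self_mem_nhdsWithin (mem_nhdsWithin_of_mem_nhds (Iic_mem_nhds h1))
    have hxt := hag _ t hmem
    rw [hxt]
    refine ⟨h2.1, ?_⟩
    refine (h2.2.mono_of_mem_nhdsWithin hnb).congr_of_eventuallyEq ?_ hxt
    filter_upwards [hnb] with r hr using hag _ r hr
  refine ⟨x, ⟨hx0, hxs⟩, ?_⟩
  rintro z ⟨hz0, hz⟩ t ht
  exact phys_unique hrank hc' hy hy0 hs hz0 hx0 (phys_sol_mono hz Icc_subset_Ici_self)
    (phys_sol_mono hxs Icc_subset_Ici_self) ⟨ht, le_rfl⟩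
end

section
/- Suppose x : [0,∞) → ℝⁿ_{>0} is a solution of the Physarum dynamics ẋ = q − x. Then the limit x^∞ = lim_{t→∞} x(t) exists; moreover x^∞ is an optimal solution of the linear program min{cᵀx : A x = b, x ≥ 0}, i.e., A x^∞ = b, x^∞ ≥ 0, and cᵀ x^∞ equals the optimal value of this LP. -/
open Matrix Filter Set Topology

theorem phys_Bq {m n : ℕ} (B : Matrix (Fin m) (Fin n) ℝ) (hrank : B.rank = m) (b : Fin m → ℝ)
    (c x : Fin n → ℝ) (hc : ∀ i, 0 < c i) (hx : ∀ i, 0 < x i) :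
    B *ᵥ physQ B b c x = b := by
  have hinj : Function.Injective B.vecMul := by
    rw [Matrix.vecMul_injective_iff, linearIndependent_iff_card_eq_finrank_span, Set.finrank,
      ← Matrix.rank_eq_finrank_span_row, hrank, Fintype.card_fin]
  have hW : (physW c x).PosDef := by
    unfold physW
    exact Matrix.PosDef.diagonal (fun i => div_pos (hx i) (hc i))
  have hL : (B * physW c x * Bᵀ).PosDef := by
    have := hW.mul_mul_conjTranspose_same (B := B) hinj
    simpa using this
  have hu : IsUnit (B * physW c x * Bᵀ).det := (Matrix.isUnit_iff_isUnit_det _).1 hL.isUnit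
  unfold physQ
  rw [Matrix.mulVec_mulVec, Matrix.mulVec_mulVec, Matrix.mulVec_mulVec, Matrix.mul_nonsing_inv _ hu,
    Matrix.one_mulVec]

theorem phys_const (f : ℝ → ℝ) (h : ∀ t ∈ Set.Ici (0:ℝ), HasDerivWithinAt f 0 (Set.Ici 0) t) :
    ∀ t, 0 ≤ t → f t = f 0 := by
  intro t ht
  refine constant_of_has_deriv_right_zero (a := 0) (b := t) ?_ ?_ t ⟨ht, le_rfl⟩
  · intro s hs
    exact ((h s hs.1).continuousWithinAt).mono Set.Icc_subset_Ici_self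
  · intro s hs
    exact (h s hs.1).mono (Set.Ici_subset_Ici.2 hs.1)

theorem phys_lin {m n : ℕ} (B : Matrix (Fin m) (Fin n) ℝ) (hrank : B.rank = m) (b : Fin m → ℝ)
    (c : Fin n → ℝ) (hc : ∀ i, 0 < c i) (x : ℝ → Fin n → ℝ)
    (hsol : IsPhysSolOn B b c x (Set.Ici 0)) (t : ℝ) (ht : 0 ≤ t) (j : Fin m) :
    (B *ᵥ x t) j = b j + Real.exp (-t) * ((B *ᵥ x 0) j - b j) := by
  have key := phys_const (fun t => Real.exp t * ((B *ᵥ x t) j - b j)) (by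
    intro s hs
    obtain ⟨hp, hd⟩ := hsol s hs
    have hd' := hasDerivWithinAt_pi.1 hd
    have h1 : HasDerivWithinAt (fun t => (B *ᵥ x t) j)
        (∑ i, B j i * (physQ B b c (x s) - x s) i) (Set.Ici 0) s := by
      have := HasDerivWithinAt.fun_sum (u := Finset.univ) (fun i _ => (hd' i).const_mul (B j i))
      exact this
    have h2 : (∑ i, B j i * (physQ B b c (x s) - x s) i) = b j - (B *ᵥ x s) j := by
      have h3 : (B *ᵥ (physQ B b c (x s) - x s)) j = b j - (B *ᵥ x s) j := by
        rw [Matrix.mulVec_sub, phys_Bq B hrank b c (x s) hc hp]; rfl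
      exact h3
    rw [h2] at h1
    have h4 := ((Real.hasDerivAt_exp s).hasDerivWithinAt (s := Set.Ici 0)).mul (h1.sub_const (b j))
    have h5 : Real.exp s * ((B *ᵥ x s) j - b j) + Real.exp s * (b j - (B *ᵥ x s) j) = 0 := by ring
    rw [h5] at h4
    exact h4) t ht
  simp only [Real.exp_zero, one_mul] at key
  rw [← key, ← mul_assoc, ← Real.exp_add]
  simp

theorem phys_log {m n : ℕ} (B : Matrix (Fin m) (Fin n) ℝ) (b : Fin m → ℝ)
    (c : Fin n → ℝ) (hc : ∀ i, 0 < c i) (x : ℝ → Fin n → ℝ)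
    (hsol : IsPhysSolOn B b c x (Set.Ici 0)) (v : Fin n → ℝ) (hv : B *ᵥ v = 0)
    (t : ℝ) (ht : 0 ≤ t) :
    ∑ i, v i * (c i * (Real.log (x t i) - Real.log (x 0 i) + t)) = 0 := by
  have key := phys_const
    (fun t => ∑ i, v i * (c i * (Real.log (x t i) - Real.log (x 0 i) + t))) (by
    intro s hs
    obtain ⟨hp, hd⟩ := hsol s hs
    have hd' := hasDerivWithinAt_pi.1 hd
    set p := (B * physW c (x s) * Bᵀ)⁻¹ *ᵥ b with hpdef
    have h1 := HasDerivWithinAt.fun_sum (u := Finset.univ) (fun i _ =>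
      (((((hd' i).log (hp i).ne').sub_const (Real.log (x 0 i))).add
        (hasDerivWithinAt_id s (Set.Ici 0))).const_mul (c i)).const_mul (v i))
    have h2 : ∀ i, v i * (c i * ((physQ B b c (x s) - x s) i / x s i + 1)) = v i * (Bᵀ *ᵥ p) i := by
      intro i
      have h3 : physQ B b c (x s) i = x s i / c i * (Bᵀ *ᵥ p) i := by
        unfold physQ physW
        rw [Matrix.mulVec_diagonal]
        rfl
      rw [Pi.sub_apply, h3]
      have := (hp i).ne'
      have := (hc i).ne'
      field_simp
      ring
    rw [Finset.sum_congr rfl (fun i _ => h2 i)] at h1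
    have h4 : v ⬝ᵥ (Bᵀ *ᵥ p) = 0 := by
      rw [Matrix.dotProduct_mulVec, Matrix.vecMul_transpose, hv, zero_dotProduct]
    have h5 : ∑ i, v i * (Bᵀ *ᵥ p) i = 0 := h4
    rw [h5] at h1
    exact h1) t ht
  simpa using key

theorem phys_ineq {m n : ℕ} (B : Matrix (Fin m) (Fin n) ℝ) (b : Fin m → ℝ)
    (c : Fin n → ℝ) (hc : ∀ i, 0 < c i) (x : ℝ → Fin n → ℝ)
    (hpos : ∀ t, 0 ≤ t → ∀ i, 0 < x t i)
    (hlin : ∀ t, 0 ≤ t → ∀ j, (B *ᵥ x t) j = b j + Real.exp (-t) * ((B *ᵥ x 0) j - b j))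
    (hlog : ∀ v : Fin n → ℝ, B *ᵥ v = 0 → ∀ t, 0 ≤ t →
      ∑ i, v i * (c i * (Real.log (x t i) - Real.log (x 0 i) + t)) = 0)
    (z : Fin n → ℝ) (hz : B *ᵥ z = b) (hz0 : ∀ i, 0 ≤ z i) :
    ∃ C₁ C₂ : ℝ, 0 ≤ C₁ ∧ 0 ≤ C₂ ∧ ∀ t, 0 ≤ t →
      t * (c ⬝ᵥ x t) ≤ t * (c ⬝ᵥ z + Real.exp (-t) * (c ⬝ᵥ x 0 - c ⬝ᵥ z)) + C₁
        + C₂ * (c ⬝ᵥ x t) := by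
  have hx0 := hpos 0 le_rfl
  have hw : ∀ i, 0 ≤ (z i + x 0 i) / x 0 i := fun i =>
    div_nonneg (add_nonneg (hz0 i) (hx0 i).le) (hx0 i).le
  refine ⟨∑ i, c i * x 0 i, ∑ i, (z i + x 0 i) / x 0 i,
    Finset.sum_nonneg fun i _ => mul_nonneg (hc i).le (hx0 i).le,
    Finset.sum_nonneg fun i _ => hw i, fun t ht => ?_⟩
  have hxt := hpos t ht
  set e := Real.exp (-t) with he
  have he0 : 0 < e := Real.exp_pos _
  have he1 : e ≤ 1 := Real.exp_le_one_iff.2 (by linarith)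
  set y : Fin n → ℝ := z + e • (x 0 - z) with hy
  have hker : B *ᵥ (y - x t) = 0 := by
    funext j
    rw [hy, Matrix.mulVec_sub, Matrix.mulVec_add, Matrix.mulVec_smul, Matrix.mulVec_sub, hz]
    simp [hlin t ht j, he]
  have h := hlog _ hker t ht
  have hcy : c ⬝ᵥ y = c ⬝ᵥ z + e * (c ⬝ᵥ x 0 - c ⬝ᵥ z) := by
    rw [hy, dotProduct_add, dotProduct_smul, dotProduct_sub]; rfl
  rw [← hcy]
  have h1 : t * (c ⬝ᵥ x t) - t * (c ⬝ᵥ y)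
      = ∑ i, c i * ((y i - x t i) * (Real.log (x t i) - Real.log (x 0 i))) := by
    have : ∑ i, c i * ((y i - x t i) * (Real.log (x t i) - Real.log (x 0 i)))
       = (∑ i, (y - x t) i * (c i * (Real.log (x t i) - Real.log (x 0 i) + t)))
        + (t * (c ⬝ᵥ x t) - t * (c ⬝ᵥ y)) := by
      simp only [dotProduct, Finset.mul_sum, ← Finset.sum_sub_distrib, ← Finset.sum_add_distrib]
      refine Finset.sum_congr rfl fun i _ => ?_
      simp only [Pi.sub_apply]
      ring
    rw [this, h, zero_add]
  have h2 : ∀ i, c i * ((y i - x t i) * (Real.log (x t i) - Real.log (x 0 i)))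
      ≤ c i * x 0 i + (∑ i, (z i + x 0 i) / x 0 i) * (c i * x t i) := by
    intro i
    have hl1 : Real.log (x t i) - Real.log (x 0 i) ≤ x t i / x 0 i - 1 := by
      rw [← Real.log_div (hxt i).ne' (hx0 i).ne']
      exact Real.log_le_sub_one_of_pos (div_pos (hxt i) (hx0 i))
    have hl2 : Real.log (x 0 i) - Real.log (x t i) ≤ x 0 i / x t i - 1 := by
      rw [← Real.log_div (hx0 i).ne' (hxt i).ne']
      exact Real.log_le_sub_one_of_pos (div_pos (hx0 i) (hxt i))
    have hyi : y i = (1 - e) * z i + e * x 0 i := by simp [hy]; ring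
    have hy0 : 0 ≤ y i := by
      rw [hyi]
      exact add_nonneg (mul_nonneg (by linarith) (hz0 i)) (mul_nonneg he0.le (hx0 i).le)
    have hy1 : y i ≤ z i + x 0 i := by
      rw [hyi]
      nlinarith [mul_nonneg he0.le (hz0 i), mul_nonneg (sub_nonneg.2 he1) (hx0 i).le]
    have a1 : y i * (Real.log (x t i) - Real.log (x 0 i)) ≤ (z i + x 0 i) / x 0 i * x t i := by
      calc y i * (Real.log (x t i) - Real.log (x 0 i)) ≤ y i * (x t i / x 0 i) :=
            mul_le_mul_of_nonneg_left (by linarith) hy0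
        _ ≤ (z i + x 0 i) * (x t i / x 0 i) :=
            mul_le_mul_of_nonneg_right hy1 (div_pos (hxt i) (hx0 i)).le
        _ = _ := by ring
    have a2 : x t i * (Real.log (x 0 i) - Real.log (x t i)) ≤ x 0 i := by
      calc _ ≤ x t i * (x 0 i / x t i - 1) := mul_le_mul_of_nonneg_left hl2 (hxt i).le
        _ = x 0 i - x t i := by
          have := (hxt i).ne'
          field_simp
        _ ≤ x 0 i := by linarith [hxt i]
    have a3 : (z i + x 0 i) / x 0 i * x t i ≤ (∑ i, (z i + x 0 i) / x 0 i) * x t i :=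
      mul_le_mul_of_nonneg_right
        (Finset.single_le_sum (f := fun i => (z i + x 0 i) / x 0 i) (fun i _ => hw i)
          (Finset.mem_univ i)) (hxt i).le
    have a4 : (y i - x t i) * (Real.log (x t i) - Real.log (x 0 i))
        ≤ x 0 i + (∑ i, (z i + x 0 i) / x 0 i) * x t i := by nlinarith
    calc _ ≤ c i * (x 0 i + (∑ i, (z i + x 0 i) / x 0 i) * x t i) :=
          mul_le_mul_of_nonneg_left a4 (hc i).le
      _ = _ := by ring
  have h3 := Finset.sum_le_sum (fun i (_ : i ∈ Finset.univ) => h2 i)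
  rw [Finset.sum_add_distrib, ← Finset.mul_sum, ← h1] at h3
  have h4 : c ⬝ᵥ x t = ∑ i, c i * x t i := rfl
  rw [← h4] at h3
  linarith

/-- limit identities along a filter -/
theorem phys_cluster {n : ℕ} (c x0 : Fin n → ℝ) (hc : ∀ i, 0 < c i) (x : ℝ → Fin n → ℝ)
    (hx0 : ∀ i, 0 < x0 i)
    (l : Filter ℝ) [l.NeBot] (hpos : ∀ᶠ t in l, ∀ i, 0 < x t i)
    (y z : Fin n → ℝ) (hy : Tendsto x l (𝓝 y)) (hy0 : ∀ i, 0 ≤ y i) (hz0 : ∀ i, 0 ≤ z i)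
    (h : ∀ᶠ t in l, ∑ i, (y i - z i) * (c i * (Real.log (x t i) - Real.log (x0 i))) = 0) :
    (∀ i, y i = 0 → z i = 0) ∧
    ∑ i, (y i - z i) * (c i * (Real.log (y i) - Real.log (x0 i))) = 0 := by
  have hyi : ∀ i, Tendsto (fun t => x t i) l (𝓝 (y i)) := fun i => (tendsto_pi_nhds.1 hy) i
  have hlog : ∀ i, y i ≠ 0 → Tendsto (fun t => Real.log (x t i)) l (𝓝 (Real.log (y i))) :=
    fun i hi => (hyi i).log hi
  have hsupp : ∀ i, y i = 0 → z i = 0 := by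
    intro j hj
    by_contra hzj
    have hzj' : 0 < z j := lt_of_le_of_ne (hz0 j) (Ne.symm hzj)
    -- the sum with y converges
    have t1 : Tendsto (fun t => ∑ i, y i * (c i * (Real.log (x t i) - Real.log (x0 i)))) l
        (𝓝 (∑ i, y i * (c i * (Real.log (y i) - Real.log (x0 i))))) := by
      refine tendsto_finsetSum _ fun i _ => ?_
      by_cases hi : y i = 0
      · simp [hi]
      · exact (((hlog i hi).sub_const _).const_mul _).const_mul _
    have t2 : Tendsto (fun t => ∑ i ∈ Finset.univ.erase j, z i * (c i * (x t i / x0 i - 1))) l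
        (𝓝 (∑ i ∈ Finset.univ.erase j, z i * (c i * (y i / x0 i - 1)))) := by
      refine tendsto_finsetSum _ fun i _ => ?_
      exact ((((hyi i).div_const _).sub_const _).const_mul _).const_mul _
    have t3 : Tendsto (fun t => z j * (c j * (Real.log (x t j) - Real.log (x0 j)))) l atBot := by
      have h0 : Tendsto (fun t => x t j) l (𝓝[>] 0) := by
        rw [tendsto_nhdsWithin_iff]
        refine ⟨hj ▸ hyi j, ?_⟩
        filter_upwards [hpos] with t ht using ht j
      have h1 := Real.tendsto_log_nhdsGT_zero.comp h0
      have h2 : Tendsto (fun t => Real.log (x t j) - Real.log (x0 j)) l atBot :=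
        tendsto_atBot_add_const_right _ _ h1
      exact (h2.const_mul_atBot (hc j)).const_mul_atBot hzj'
    have t4 := t1.sub t2
    set R := (∑ i, y i * (c i * (Real.log (y i) - Real.log (x0 i))))
      - ∑ i ∈ Finset.univ.erase j, z i * (c i * (y i / x0 i - 1)) with hR
    have e1 := t4.eventually (lt_mem_nhds (sub_one_lt R))
    have e2 := t3.eventually (eventually_le_atBot (R - 1))
    obtain ⟨t, h1, h2, h3, h4⟩ := (e1.and (e2.and (h.and hpos))).exists
    have h5 : ∑ i ∈ Finset.univ.erase j, z i * (c i * (Real.log (x t i) - Real.log (x0 i)))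
        ≤ ∑ i ∈ Finset.univ.erase j, z i * (c i * (x t i / x0 i - 1)) := by
      refine Finset.sum_le_sum fun i _ => ?_
      refine mul_le_mul_of_nonneg_left (mul_le_mul_of_nonneg_left ?_ (hc i).le) (hz0 i)
      rw [← Real.log_div (h4 i).ne' (hx0 i).ne']
      exact Real.log_le_sub_one_of_pos (div_pos (h4 i) (hx0 i))
    have h6 := Finset.add_sum_erase Finset.univ
      (fun i => z i * (c i * (Real.log (x t i) - Real.log (x0 i)))) (Finset.mem_univ j)
    simp only [sub_mul, Finset.sum_sub_distrib] at h3
    linarith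
  refine ⟨hsupp, ?_⟩
  have t1 : Tendsto (fun t => ∑ i, (y i - z i) * (c i * (Real.log (x t i) - Real.log (x0 i)))) l
      (𝓝 (∑ i, (y i - z i) * (c i * (Real.log (y i) - Real.log (x0 i))))) := by
    refine tendsto_finsetSum _ fun i _ => ?_
    by_cases hi : y i = 0
    · simp [hi, hsupp i hi]
    · exact (((hlog i hi).sub_const _).const_mul _).const_mul _
  refine tendsto_nhds_unique t1 (tendsto_const_nhds.congr' ?_)
  filter_upwards [h] with t ht using ht.symm

theorem phys_core {m n : ℕ} (B : Matrix (Fin m) (Fin n) ℝ) (b : Fin m → ℝ)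
    (c : Fin n → ℝ) (hc : ∀ i, 0 < c i) (x : ℝ → Fin n → ℝ)
    (hfeas : ∃ y : Fin n → ℝ, B *ᵥ y = b ∧ ∀ i, 0 ≤ y i)
    (hpos : ∀ t, 0 ≤ t → ∀ i, 0 < x t i)
    (hlin : ∀ t, 0 ≤ t → ∀ j, (B *ᵥ x t) j = b j + Real.exp (-t) * ((B *ᵥ x 0) j - b j))
    (hlog : ∀ v : Fin n → ℝ, B *ᵥ v = 0 → ∀ t, 0 ≤ t →
      ∑ i, v i * (c i * (Real.log (x t i) - Real.log (x 0 i) + t)) = 0) :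
    ∃ xinf : Fin n → ℝ, Tendsto x atTop (𝓝 xinf) ∧ B *ᵥ xinf = b ∧ (∀ i, 0 ≤ xinf i) ∧
      ∀ z : Fin n → ℝ, B *ᵥ z = b → (∀ i, 0 ≤ z i) → c ⬝ᵥ xinf ≤ c ⬝ᵥ z := by
  have hexp : Tendsto (fun t : ℝ => Real.exp (-t)) atTop (𝓝 0) := Real.tendsto_exp_neg_atTop_nhds_zero
  -- cluster points are optimal
  have hopt : ∀ y, MapClusterPt y atTop x → B *ᵥ y = b ∧ (∀ i, 0 ≤ y i) ∧
      ∀ z : Fin n → ℝ, B *ᵥ z = b → (∀ i, 0 ≤ z i) → c ⬝ᵥ y ≤ c ⬝ᵥ z := by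
    intro y hy
    obtain ⟨U, hU, hUy⟩ := mapClusterPt_iff_ultrafilter.1 hy
    have hge : ∀ᶠ t in (U : Filter ℝ), 0 < t := hU (eventually_gt_atTop 0)
    have hcx : Tendsto (fun t => c ⬝ᵥ x t) U (𝓝 (c ⬝ᵥ y)) :=
      ((continuous_const.dotProduct continuous_id).tendsto y).comp hUy
    have hexpU := hexp.mono_left hU
    refine ⟨?_, ?_, ?_⟩
    · funext j
      have h1 : Tendsto (fun t => (B *ᵥ x t) j) U (𝓝 ((B *ᵥ y) j)) :=
        (((continuous_apply j).comp (continuous_const.matrix_mulVec continuous_id)).tendsto y).comp hUy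
      have h2 : Tendsto (fun t => b j + Real.exp (-t) * ((B *ᵥ x 0) j - b j)) U
          (𝓝 (b j + 0 * ((B *ᵥ x 0) j - b j))) := (hexpU.mul_const _).const_add _
      have h3 := tendsto_nhds_unique h1 (h2.congr' (by
        filter_upwards [hge] with t ht using (hlin t ht.le j).symm))
      simpa using h3
    · intro i
      refine ge_of_tendsto ((tendsto_pi_nhds.1 hUy) i) ?_
      filter_upwards [hge] with t ht using (hpos t ht.le i).le
    · intro z hz hz0
      obtain ⟨C₁, C₂, -, -, h⟩ := phys_ineq B b c hc x hpos hlin hlog z hz hz0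
      have hinv : Tendsto (fun t : ℝ => t⁻¹) U (𝓝 0) := tendsto_inv_atTop_zero.mono_left hU
      have hR : Tendsto (fun t => (c ⬝ᵥ z + Real.exp (-t) * (c ⬝ᵥ x 0 - c ⬝ᵥ z)) + t⁻¹ * C₁
        + t⁻¹ * (C₂ * (c ⬝ᵥ x t))) U (𝓝 ((c ⬝ᵥ z + 0 * (c ⬝ᵥ x 0 - c ⬝ᵥ z)) + 0 * C₁
        + 0 * (C₂ * (c ⬝ᵥ y)))) :=
        (((hexpU.mul_const _).const_add _).add (hinv.mul_const _)).add
          (hinv.mul (hcx.const_mul _))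
      have := le_of_tendsto_of_tendsto hcx hR (by
        filter_upwards [hge] with t ht
        have h1 := mul_le_mul_of_nonneg_left (h t ht.le) (inv_pos.2 ht).le
        have h2 : t⁻¹ * t = 1 := inv_mul_cancel₀ ht.ne'
        calc c ⬝ᵥ x t = t⁻¹ * (t * (c ⬝ᵥ x t)) := by rw [← mul_assoc, h2, one_mul]
          _ ≤ _ := h1
          _ = (t⁻¹ * t) * (c ⬝ᵥ z + Real.exp (-t) * (c ⬝ᵥ x 0 - c ⬝ᵥ z)) + t⁻¹ * C₁
              + t⁻¹ * (C₂ * (c ⬝ᵥ x t)) := by ring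
          _ = _ := by rw [h2, one_mul])
      simpa using this
  -- boundedness
  obtain ⟨K, hK, hmem⟩ : ∃ K : Set (Fin n → ℝ), IsCompact K ∧ ∀ᶠ t in atTop, x t ∈ K := by
    obtain ⟨z, hz, hz0⟩ := hfeas
    obtain ⟨C₁, C₂, hC₁, hC₂, h⟩ := phys_ineq B b c hc x hpos hlin hlog z hz hz0
    set M := 2 * (c ⬝ᵥ z + c ⬝ᵥ x 0) + 2 * C₁ with hM
    refine ⟨Set.Icc 0 (fun i => M / c i), isCompact_Icc, ?_⟩
    filter_upwards [eventually_ge_atTop (2 * C₂ + 1)] with t ht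
    have ht1 : 1 ≤ t := by linarith
    have hxt := hpos t (by linarith)
    have hterm : ∀ i, 0 ≤ c i * x t i := fun i => mul_nonneg (hc i).le (hxt i).le
    have hcx0 : 0 ≤ c ⬝ᵥ x t := Finset.sum_nonneg fun i _ => hterm i
    have hcz0 : 0 ≤ c ⬝ᵥ z := Finset.sum_nonneg fun i _ => mul_nonneg (hc i).le (hz0 i)
    have hc00 : 0 ≤ c ⬝ᵥ x 0 :=
      Finset.sum_nonneg fun i _ => mul_nonneg (hc i).le (hpos 0 le_rfl i).le
    have h1 := h t (by linarith)
    have he0 : 0 < Real.exp (-t) := Real.exp_pos _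
    have he1 : Real.exp (-t) ≤ 1 := Real.exp_le_one_iff.2 (by linarith)
    have h2 : c ⬝ᵥ z + Real.exp (-t) * (c ⬝ᵥ x 0 - c ⬝ᵥ z) ≤ c ⬝ᵥ z + c ⬝ᵥ x 0 := by
      nlinarith [mul_nonneg he0.le hcz0, mul_nonneg (sub_nonneg.2 he1) hc00]
    have h3 := mul_le_mul_of_nonneg_left h2 (by linarith : (0:ℝ) ≤ t)
    have h4 : C₁ ≤ t * C₁ := by nlinarith
    have h5 : C₂ * (c ⬝ᵥ x t) ≤ t / 2 * (c ⬝ᵥ x t) :=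
      mul_le_mul_of_nonneg_right (by linarith) hcx0
    have h6 : t * (c ⬝ᵥ x t) ≤ t * M := by rw [hM]; nlinarith
    have h7 : c ⬝ᵥ x t ≤ M := le_of_mul_le_mul_left h6 (by linarith)
    refine ⟨fun i => (hxt i).le, fun i => ?_⟩
    show x t i ≤ M / c i
    rw [le_div_iff₀ (hc i), mul_comm]
    exact (Finset.single_le_sum (f := fun i => c i * x t i) (fun i _ => hterm i)
          (Finset.mem_univ i)).trans h7
  -- existence of a cluster point
  obtain ⟨y, hyK, hy⟩ := hK.exists_mapClusterPt (u := x) (f := atTop) (by simpa using hmem)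
  -- relation between cluster points
  have hrel : ∀ y z, MapClusterPt y atTop x → MapClusterPt z atTop x →
      (∀ i, y i = 0 → z i = 0) ∧
      ∑ i, (y i - z i) * (c i * (Real.log (y i) - Real.log (x 0 i))) = 0 := by
    intro y z hy hz
    obtain ⟨hyb, hy0, hyo⟩ := hopt y hy
    obtain ⟨hzb, hz0, hzo⟩ := hopt z hz
    have hc' : c ⬝ᵥ y = c ⬝ᵥ z := le_antisymm (hyo z hzb hz0) (hzo y hyb hy0)
    obtain ⟨U, hU, hUy⟩ := mapClusterPt_iff_ultrafilter.1 hy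
    have hge : ∀ᶠ t in (U : Filter ℝ), 0 < t := hU (eventually_gt_atTop 0)
    refine phys_cluster c (x 0) hc x (hpos 0 le_rfl) U ?_ y z hUy hy0 hz0 ?_
    · filter_upwards [hge] with t ht using hpos t ht.le
    · filter_upwards [hge] with t ht
      have h1 := hlog (y - z) (by rw [Matrix.mulVec_sub, hyb, hzb, sub_self]) t ht.le
      have h2 : ∑ i, (y - z) i * (c i * (Real.log (x t i) - Real.log (x 0 i) + t))
        = ∑ i, (y i - z i) * (c i * (Real.log (x t i) - Real.log (x 0 i)))
          + t * (c ⬝ᵥ y - c ⬝ᵥ z) := by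
        simp only [dotProduct, Finset.mul_sum, ← Finset.sum_sub_distrib, ← Finset.sum_add_distrib]
        refine Finset.sum_congr rfl fun i _ => ?_
        simp only [Pi.sub_apply]
        ring
      rw [h2, hc', sub_self, mul_zero, add_zero] at h1
      exact h1
  have huniq : ∀ z, MapClusterPt z atTop x → z = y := by
    intro z hz
    obtain ⟨s1, e1⟩ := hrel y z hy hz
    obtain ⟨s2, e2⟩ := hrel z y hz hy
    have hy0 := (hopt y hy).2.1
    have hz0 := (hopt z hz).2.1
    have e3 : ∑ i, c i * ((z i - y i) * (Real.log (z i) - Real.log (y i))) = 0 := by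
      have : ∑ i, c i * ((z i - y i) * (Real.log (z i) - Real.log (y i)))
        = ∑ i, (z i - y i) * (c i * (Real.log (z i) - Real.log (x 0 i)))
          + ∑ i, (y i - z i) * (c i * (Real.log (y i) - Real.log (x 0 i))) := by
        rw [← Finset.sum_add_distrib]
        exact Finset.sum_congr rfl fun i _ => by ring
      rw [this, e1, e2, add_zero]
    have hstrict : ∀ i, z i ≠ y i → 0 < (z i - y i) * (Real.log (z i) - Real.log (y i)) := by
      intro i hne
      have hyp : 0 < y i := by
        refine lt_of_le_of_ne (hy0 i) fun h => hne ?_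
        rw [s1 i h.symm, ← h]
      have hzp : 0 < z i := by
        refine lt_of_le_of_ne (hz0 i) fun h => hne ?_
        rw [s2 i h.symm, ← h]
      rcases lt_or_gt_of_ne hne with hlt | hlt
      · exact mul_pos_of_neg_of_neg (sub_neg.2 hlt) (sub_neg.2 (Real.log_lt_log hzp hlt))
      · exact mul_pos (sub_pos.2 hlt) (sub_pos.2 (Real.log_lt_log hyp hlt))
    have hnn : ∀ i ∈ Finset.univ, 0 ≤ c i * ((z i - y i) * (Real.log (z i) - Real.log (y i))) := by
      intro i _
      by_cases hi : z i = y i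
      · simp [hi]
      · exact (mul_pos (hc i) (hstrict i hi)).le
    funext i
    by_contra hne
    have := (Finset.sum_eq_zero_iff_of_nonneg hnn).1 e3 i (Finset.mem_univ i)
    exact (mul_pos (hc i) (hstrict i hne)).ne' this
  exact ⟨y, hK.tendsto_nhds_of_unique_mapClusterPt hmem (fun z _ hz => huniq z hz), hopt y hy⟩


theorem physarum_converges_to_optimal_solution {m n : ℕ} (A : Matrix (Fin m) (Fin n) ℤ)
    (hrank : (rmat A).rank = m)
    (b : Fin m → ℤ) (c : Fin n → ℤ) (hc : ∀ i, 0 < c i)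
    (hfeas : ∃ y : Fin n → ℝ, (rmat A *ᵥ y = fun j => (b j : ℝ)) ∧ ∀ i, 0 ≤ y i)
    (x : ℝ → Fin n → ℝ)
    (hsol : IsPhysSolOn (rmat A) (fun j => (b j : ℝ)) (fun i => (c i : ℝ)) x (Set.Ici 0)) :
    ∃ xinf : Fin n → ℝ,
      Filter.Tendsto x Filter.atTop (nhds xinf) ∧
      (rmat A *ᵥ xinf = fun j => (b j : ℝ)) ∧ (∀ i, 0 ≤ xinf i) ∧
      ∀ z : Fin n → ℝ, (rmat A *ᵥ z = fun j => (b j : ℝ)) → (∀ i, 0 ≤ z i) →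
        (fun i => (c i : ℝ)) ⬝ᵥ xinf ≤ (fun i => (c i : ℝ)) ⬝ᵥ z := by
  obtain ⟨y, hy, hy0⟩ := hfeas
  have hc' : ∀ i, (0:ℝ) < (fun i => (c i : ℝ)) i := fun i => Int.cast_pos.2 (hc i)
  exact phys_core (rmat A) (fun j => (b j : ℝ)) (fun i => (c i : ℝ)) hc' x ⟨y, hy, hy0⟩
    (fun t ht => (hsol t ht).1)
    (fun t ht j => phys_lin (rmat A) hrank _ _ hc' x hsol t ht j)
    (fun v hv t ht => phys_log (rmat A) _ _ hc' x hsol v hv t ht)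
end

section
/- Consider the discrete Physarum dynamics x(k+1) = (1−h) x(k) + h q(k), initialized at x(0) = s with A s = b, M⁻¹ ≤ sᵢ ≤ M for all i and some M ≥ 1, and cᵀs ≤ M · opt, where opt is the optimal value of min{cᵀx : A x = b, x ≥ 0}. Let 0 < ε < 1/2 and set h = (ε/6) · C_s⁻² · 𝒟⁻². Then for k = O((ln M)/(ε² h²)), the iterate x(k) is strictly positive and feasible (A x(k) = b, x(k) > 0) and satisfies opt ≤ cᵀ x(k) ≤ (1+ε) · opt. -/
open Matrix Filter Set Topology

lemma phys_det_expand {m n : ℕ} (M : Matrix (Fin m) (Fin n) ℝ) (N : Matrix (Fin n) (Fin m) ℝ) :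
    (M * N).det = ∑ f : Fin m → Fin n, (∏ i, M i (f i)) * (N.submatrix f id).det := by
  have h1 : (M * N) = fun i => ∑ j, M i j • N j := by
    ext i k
    simp [Matrix.mul_apply, Finset.sum_apply]
  have h2 := (Matrix.detRowAlternating (R := ℝ) (n := Fin m)).toMultilinearMap.map_sum
    (fun i j => M i j • N j)
  have h3 : (M * N).det = (Matrix.detRowAlternating (R := ℝ) (n := Fin m)).toMultilinearMap
      (fun i => ∑ j, M i j • N j) := by rw [h1]; rfl
  rw [h3, h2]
  refine Finset.sum_congr rfl fun f _ => ?_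
  have h4 := (Matrix.detRowAlternating (R := ℝ) (n := Fin m)).toMultilinearMap.map_smul_univ
    (fun i => M i (f i)) (fun i => N (f i))
  rw [h4]; rfl

lemma phys_cauchyBinet {m n : ℕ} (M : Matrix (Fin m) (Fin n) ℝ) (N : Matrix (Fin n) (Fin m) ℝ) :
    (m.factorial : ℝ) * (M * N).det =
      ∑ f : Fin m → Fin n, (M.submatrix id f).det * (N.submatrix f id).det := by
  have key : ∀ σ : Equiv.Perm (Fin m),
      ∑ f : Fin m → Fin n, ((Equiv.Perm.sign σ : ℤ) : ℝ) * (∏ i, M (σ i) (f i)) *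
        (N.submatrix f id).det = (M * N).det := by
    intro σ
    rw [phys_det_expand]
    symm
    refine Fintype.sum_equiv (Equiv.arrowCongr σ.symm (Equiv.refl _)) _ _ fun g => ?_
    have e : (Equiv.arrowCongr σ.symm (Equiv.refl (Fin n))) g = g ∘ σ := by
      ext i; simp [Equiv.arrowCongr]
    rw [e]
    have h1 : (N.submatrix (g ∘ σ) id).det =
        ((Equiv.Perm.sign σ : ℤ) : ℝ) * (N.submatrix g id).det := by
      rw [← Matrix.det_permute σ (N.submatrix g id)]; rfl
    have h2 : ∏ i, M (σ i) ((g ∘ σ) i) = ∏ i, M i (g i) :=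
      Equiv.prod_comp σ (fun i => M i (g i))
    rw [h1, h2]
    have h3 : ((Equiv.Perm.sign σ : ℤ) : ℝ) * ((Equiv.Perm.sign σ : ℤ) : ℝ) = 1 := by
      rcases Int.units_eq_one_or (Equiv.Perm.sign σ) with h | h <;> simp [h]
    linear_combination (-(∏ i, M i (g i)) * (N.submatrix g id).det) * h3
  have hc : (m.factorial : ℝ) * (M * N).det = ∑ σ : Equiv.Perm (Fin m), (M * N).det := by
    simp [Fintype.card_perm]
  rw [hc, ← Finset.sum_congr rfl (fun σ _ => key σ), Finset.sum_comm]
  refine Finset.sum_congr rfl fun f _ => ?_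
  rw [← Finset.sum_mul, Matrix.det_apply' (M.submatrix id f)]
  rfl

lemma phys_posDef {m n : ℕ} (B : Matrix (Fin m) (Fin n) ℝ) (hr : B.rank = m) (w : Fin n → ℝ)
    (hw : ∀ i, 0 < w i) : 0 < (B * Matrix.diagonal w * Bᵀ).det := by
  have hli : LinearIndependent ℝ B.row := by
    rw [linearIndependent_iff_card_eq_finrank_span, Set.finrank, ← B.rank_eq_finrank_span_row, hr]
    simp
  have hinj : Function.Injective B.vecMul := Matrix.vecMul_injective_iff.mpr hli
  have := (Matrix.PosDef.diagonal hw).mul_mul_conjTranspose_same (B := B) hinj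
  rw [Matrix.conjTranspose_eq_transpose_of_trivial] at this
  exact this.det_pos

lemma phys_minor_le {m n : ℕ} (A : Matrix (Fin m) (Fin n) ℤ) (D : ℝ)
    (hD : IsGreatest (subdets A) D) (f : Fin m → Fin n) :
    |((rmat A).submatrix id f).det| ≤ D := by
  have hcast : ((rmat A).submatrix id f).det = ((A.submatrix id f).det : ℝ) := by
    rw [Int.cast_det]; rfl
  rw [hcast]
  by_cases hf : Function.Injective f
  · exact hD.2 ⟨m, id, f, Function.injective_id, hf, rfl⟩
  · rw [Function.Injective] at hf
    push Not at hf
    obtain ⟨a, b, hab, hne⟩ := hf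
    have h0 : (A.submatrix id f).det = 0 :=
      Matrix.det_zero_of_column_eq hne (fun k => by simp [hab])
    rw [h0]
    have := hD.2 ⟨0, Fin.elim0, Fin.elim0, fun x => x.elim0, fun x => x.elim0, rfl⟩
    exact le_trans (by simp) this

lemma phys_one_le {m n : ℕ} (A : Matrix (Fin m) (Fin n) ℤ) (D : ℝ)
    (hD : IsGreatest (subdets A) D) : 1 ≤ D := by
  have := hD.2 ⟨0, Fin.elim0, Fin.elim0, fun x => x.elim0, fun x => x.elim0, rfl⟩
  simpa using this

lemma phys_minor_sq {m n : ℕ} (A : Matrix (Fin m) (Fin n) ℤ) (f : Fin m → Fin n) :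
    |((rmat A).submatrix id f).det| ≤ ((rmat A).submatrix id f).det ^ 2 := by
  have hcast : ((rmat A).submatrix id f).det = ((A.submatrix id f).det : ℝ) := by
    rw [Int.cast_det]; rfl
  rw [hcast]
  have h : |(A.submatrix id f).det| ≤ (A.submatrix id f).det ^ 2 := by
    rw [← sq_abs]
    exact Int.le_self_sq _
  exact_mod_cast h

lemma phys_diff {m n : ℕ} (A : Matrix (Fin m) (Fin n) ℤ) (D : ℝ)
    (hD : IsGreatest (subdets A) D) (i j : Fin n) (f : Fin m → Fin n)
    (hf : Function.Injective f) :
    |(((rmat A).updateCol j (fun k => rmat A k j + rmat A k i)).submatrix id f).det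
      - ((rmat A).submatrix id f).det| ≤ D := by
  have hD1 := phys_one_le A D hD
  by_cases hj : ∃ k, f k = j
  · obtain ⟨k, hk⟩ := hj
    have e1 : ((rmat A).updateCol j (fun k => rmat A k j + rmat A k i)).submatrix id f
        = ((rmat A).submatrix id f).updateCol k
          ((fun a => rmat A a j) + (fun a => rmat A a i)) := by
      ext a l
      by_cases hl : l = k
      · subst hl; simp [hk]
      · have : f l ≠ j := fun h => hl (hf (h.trans hk.symm))
        simp [Matrix.updateCol_apply, hl, this]
    have e2 : ((rmat A).submatrix id f).updateCol k (fun a => rmat A a j)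
        = (rmat A).submatrix id f := by
      ext a l
      by_cases hl : l = k
      · subst hl; simp [hk]
      · simp [Matrix.updateCol_apply, hl]
    have e3 : ((rmat A).submatrix id f).updateCol k (fun a => rmat A a i)
        = (rmat A).submatrix id (Function.update f k i) := by
      ext a l
      by_cases hl : l = k
      · subst hl; simp
      · simp [Matrix.updateCol_apply, hl]
    rw [e1, Matrix.det_updateCol_add, e2, e3, add_sub_cancel_left]
    exact phys_minor_le A D hD _
  · push Not at hj
    have e1 : ((rmat A).updateCol j (fun k => rmat A k j + rmat A k i)).submatrix id f
        = (rmat A).submatrix id f := by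
      ext a l
      simp [Matrix.updateCol_apply, hj l]
    rw [e1]; simp; linarith

lemma phys_key {m n : ℕ} (A : Matrix (Fin m) (Fin n) ℤ) (hr : (rmat A).rank = m) (D : ℝ)
    (hD : IsGreatest (subdets A) D) (w : Fin n → ℝ) (hw : ∀ i, 0 < w i) (i j : Fin n) :
    |w j * ((fun k => rmat A k j) ⬝ᵥ
      ((rmat A * Matrix.diagonal w * (rmat A)ᵀ)⁻¹ *ᵥ (fun k => rmat A k i)))| ≤ D := by
  set B := rmat A with hB
  set L := B * Matrix.diagonal w * Bᵀ with hL
  set S := ((fun k => B k j) ⬝ᵥ (L⁻¹ *ᵥ (fun k => B k i))) with hS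
  have hLpos : 0 < L.det := phys_posDef B hr w hw
  set U := B.updateCol j (fun k => B k j + B k i) with hU
  set N := Matrix.diagonal w * Bᵀ with hN
  have hLN : L = B * N := by rw [hL, hN, Matrix.mul_assoc]
  have hUN : U * N = L + replicateCol Unit (fun k => B k i) *
      replicateRow Unit (fun k => w j * B k j) := by
    have hUB : U = B + Matrix.vecMulVec (fun k => B k i) (Pi.single j 1) := by
      ext a l
      by_cases hl : l = j
      · subst hl; simp [hU, Matrix.vecMulVec_apply]
      · simp [hU, Matrix.updateCol_apply, hl, Matrix.vecMulVec_apply]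
    rw [hUB, Matrix.add_mul, ← hLN]
    congr 1
    ext a l
    simp [Matrix.mul_apply, Matrix.vecMulVec_apply, hN, Matrix.diagonal_apply, Pi.single_apply]
  have hdet : (U * N).det = L.det * (1 + w j * S) := by
    rw [hUN, Matrix.det_add_replicateCol_mul_replicateRow hLpos.ne'.isUnit]
    congr 1
    rw [Matrix.det_unique]
    simp only [Matrix.add_apply, Matrix.one_apply_eq]
    congr 1
    rw [hS, Matrix.mul_assoc, Matrix.mul_apply]
    simp only [dotProduct, Matrix.mulVec, Matrix.mul_apply, Finset.mul_sum]
    simp [mul_assoc, Finset.mul_sum]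
  have hNf : ∀ f : Fin m → Fin n, (N.submatrix f id).det
      = (∏ k, w (f k)) * (B.submatrix id f).det := by
    intro f
    have : N.submatrix f id = Matrix.of fun a l => w (f a) * (B.submatrix id f)ᵀ a l := by
      ext a l; simp [hN]
    rw [this, Matrix.det_mul_column, Matrix.det_transpose]
  have cb1 := phys_cauchyBinet U N
  have cb2 := phys_cauchyBinet B N
  rw [hdet] at cb1
  rw [← hLN] at cb2
  have hfac : (0:ℝ) < m.factorial := by exact_mod_cast m.factorial_pos
  have hdiff : (m.factorial : ℝ) * L.det * (w j * S) =
      ∑ f : Fin m → Fin n, ((U.submatrix id f).det - (B.submatrix id f).det) *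
        ((∏ k, w (f k)) * (B.submatrix id f).det) := by
    simp only [sub_mul, Finset.sum_sub_distrib]
    simp only [hNf] at cb1 cb2
    rw [← cb1, ← cb2]; ring
  have hle : |(m.factorial : ℝ) * L.det * (w j * S)| ≤ (m.factorial : ℝ) * L.det * D := by
    rw [hdiff, cb2, Finset.sum_mul]
    refine (Finset.abs_sum_le_sum_abs _ _).trans (Finset.sum_le_sum fun f _ => ?_)
    rw [hNf]
    have hwf : 0 < ∏ k, w (f k) := Finset.prod_pos fun k _ => hw _
    by_cases hf : Function.Injective f
    · have h1 := phys_diff A D hD i j f hf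
      have h2 := phys_minor_sq A f
      rw [abs_mul, abs_mul, abs_of_pos hwf]
      calc _ ≤ D * ((∏ k, w (f k)) * (B.submatrix id f).det ^ 2) := by
            gcongr
            exact (abs_nonneg _).trans h1
        _ = _ := by ring
    · rw [Function.Injective] at hf
      push Not at hf
      obtain ⟨a, b, hab, hne⟩ := hf
      have h0 : (B.submatrix id f).det = 0 :=
        Matrix.det_zero_of_column_eq hne (fun k => by simp [hab])
      simp [h0]
  rw [abs_mul, abs_of_pos (mul_pos hfac hLpos)] at hle
  exact le_of_mul_le_mul_left hle (mul_pos hfac hLpos)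

/-- structure of one step -/
lemma phys_step {m n : ℕ} (A : Matrix (Fin m) (Fin n) ℤ) (hr : (rmat A).rank = m) (D : ℝ)
    (hD : IsGreatest (subdets A) D) (b : Fin m → ℝ) (c x : Fin n → ℝ) (hc : ∀ i, 1 ≤ c i)
    (hx : ∀ i, 0 < x i) (hAx : rmat A *ᵥ x = b) :
    ∃ (r : Fin n → ℝ) (E : ℝ), (∀ i, physQ (rmat A) b c x i = x i * r i) ∧
      (∀ i, |r i| ≤ D * ∑ j, c j) ∧ rmat A *ᵥ physQ (rmat A) b c x = b ∧
      (∀ y : Fin n → ℝ, rmat A *ᵥ y = b → ∑ i, y i * (c i * r i) = E) := by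
  have hc0 : ∀ i, 0 < c i := fun i => lt_of_lt_of_le one_pos (hc i)
  have hw : ∀ i, 0 < x i / c i := fun i => div_pos (hx i) (hc0 i)
  have hLpos := phys_posDef (rmat A) hr _ hw
  set B := rmat A with hB
  have hWdef : physW c x = Matrix.diagonal (fun i => x i / c i) := rfl
  set L := B * Matrix.diagonal (fun i => x i / c i) * Bᵀ with hL
  set p := L⁻¹ *ᵥ b with hp
  have hq : physQ B b c x = Matrix.diagonal (fun i => x i / c i) *ᵥ (Bᵀ *ᵥ p) := rfl
  have hc' : ∀ i, c i ≠ 0 := fun i => (hc0 i).ne'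
  refine ⟨fun i => (Bᵀ *ᵥ p) i / c i, b ⬝ᵥ p, ?_, ?_, ?_, ?_⟩
  · intro i
    rw [hq, Matrix.mulVec_diagonal]
    ring
  · intro i
    have hb : b = ∑ j, x j • (fun k => B k j) := by
      rw [← hAx]; ext k
      simp [Matrix.mulVec, dotProduct, mul_comm]
    have h1 : (Bᵀ *ᵥ p) i = ∑ j, x j * ((fun k => B k i) ⬝ᵥ (L⁻¹ *ᵥ (fun k => B k j))) := by
      have : (Bᵀ *ᵥ p) i = (fun k => B k i) ⬝ᵥ p := rfl
      rw [this, hp, hb, Matrix.mulVec_sum, dotProduct_sum]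
      simp [Matrix.mulVec_smul]
    have hsymm : ∀ j, (fun k => B k i) ⬝ᵥ (L⁻¹ *ᵥ (fun k => B k j))
        = (fun k => B k j) ⬝ᵥ (L⁻¹ *ᵥ (fun k => B k i)) := by
      intro j
      have hLt : L⁻¹ᵀ = L⁻¹ := by
        rw [Matrix.transpose_nonsing_inv]
        congr 1
        simp [hL, Matrix.transpose_mul, Matrix.mul_assoc]
      rw [Matrix.dotProduct_mulVec, dotProduct_comm, ← Matrix.mulVec_transpose, hLt]
    have h2 : |(Bᵀ *ᵥ p) i| ≤ D * ∑ j, c j := by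
      rw [h1, Finset.mul_sum]
      refine (Finset.abs_sum_le_sum_abs _ _).trans (Finset.sum_le_sum fun j _ => ?_)
      rw [hsymm]
      have h3 := phys_key A hr D hD _ hw i j
      have h4 : x j * ((fun k => B k j) ⬝ᵥ (L⁻¹ *ᵥ (fun k => B k i)))
        = (x j / c j * ((fun k => B k j) ⬝ᵥ (L⁻¹ *ᵥ (fun k => B k i)))) * c j := by
        field_simp [hc' j]
      rw [h4, abs_mul, abs_of_pos (hc0 j)]
      exact mul_le_mul_of_nonneg_right h3 (hc0 j).le
    rw [abs_div, abs_of_pos (hc0 i)]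
    exact (div_le_self (abs_nonneg _) (hc i)).trans h2
  · rw [hq, Matrix.mulVec_mulVec, Matrix.mulVec_mulVec, ← hL, hp, Matrix.mulVec_mulVec,
      Matrix.mul_nonsing_inv _ hLpos.ne'.isUnit, Matrix.one_mulVec]
  · intro y hy
    have : ∀ i, y i * (c i * ((Bᵀ *ᵥ p) i / c i)) = y i * (Bᵀ *ᵥ p) i := by
      intro i; rw [mul_div_cancel₀ _ (hc' i)]
    simp only [this]
    rw [← hy]
    change y ⬝ᵥ (Bᵀ *ᵥ p) = _
    rw [Matrix.dotProduct_mulVec, Matrix.vecMul_transpose]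

lemma phys_log_lower {z : ℝ} (hz : -(1/2) ≤ z) : z - 2 * z ^ 2 ≤ Real.log (1 + z) := by
  have h1 : 0 < 1 + z := by linarith
  have h2 := Real.one_sub_inv_le_log_of_pos h1
  refine le_trans ?_ h2
  have h3 : 1 - (1 + z)⁻¹ - (z - 2 * z ^ 2) = z ^ 2 * (1 + 2 * z) / (1 + z) := by
    field_simp; ring
  have h4 : 0 ≤ z ^ 2 * (1 + 2 * z) / (1 + z) :=
    div_nonneg (mul_nonneg (sq_nonneg _) (by linarith)) h1.le
  linarith

lemma phys_factor {K h ε r : ℝ} (hK : 1 ≤ K) (hh : 0 < h) (hε : 0 < ε) (hε2 : ε < 1 / 2)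
    (hhK : h * K ^ 2 = ε / 6) (hr : |r| ≤ K) : -(1/2) ≤ h * (r - 1) := by
  have h1 := (abs_le.mp hr).1
  have h2 : K ≤ K ^ 2 := by nlinarith
  have h3 : h * (r - 1) ≥ h * (- K ^ 2 - K ^ 2) := by
    apply mul_le_mul_of_nonneg_left _ hh.le
    linarith
  nlinarith

set_option maxHeartbeats 1000000 in
lemma phys_potential {n : ℕ} (c x z r : Fin n → ℝ) (K h ε opt E : ℝ) (hc : ∀ i, 1 ≤ c i)
    (hx : ∀ i, 0 < x i) (hz : ∀ i, 0 ≤ z i) (hK : 1 ≤ K) (hr : ∀ i, |r i| ≤ K)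
    (hh : 0 < h) (hε : 0 < ε) (hε2 : ε < 1 / 2) (hhK : h * K ^ 2 = ε / 6)
    (hopt : ∑ i, c i * z i = opt) (hopt0 : 0 < opt)
    (hEz : ∑ i, z i * (c i * r i) = E) (hEx : ∑ i, x i * (c i * r i) = E)
    (hEq : ∑ i, (x i * r i) * (c i * r i) = E) :
    0 ≤ E ∧ E ≤ ∑ i, c i * x i ∧
    ∑ i, c i * ((1 - h) * x i + h * (x i * r i)) =
      ∑ i, c i * x i - h * (∑ i, c i * x i - E) ∧
    ((1 + ε) * opt < ∑ i, c i * x i → 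
      (∑ i, z i * c i * Real.log (x i)) / opt - 18 / ε * Real.log (∑ i, c i * x i) + h * ε / 6 ≤
      (∑ i, z i * c i * Real.log ((1 - h) * x i + h * (x i * r i))) / opt
        - 18 / ε * Real.log (∑ i, c i * ((1 - h) * x i + h * (x i * r i)))) := by
  have hc0 : ∀ i, 0 < c i := fun i => lt_of_lt_of_le one_pos (hc i)
  have hE0 : 0 ≤ E := by
    rw [← hEq]
    refine Finset.sum_nonneg fun i _ => ?_
    have : x i * r i * (c i * r i) = x i * c i * r i ^ 2 := by ring
    rw [this]
    exact mul_nonneg (mul_nonneg (hx i).le (hc0 i).le) (sq_nonneg _)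
  have hEV : E ≤ ∑ i, c i * x i := by
    have h1 : 0 ≤ ∑ i, x i * c i * (r i - 1) ^ 2 := Finset.sum_nonneg fun i _ =>
      mul_nonneg (mul_nonneg (hx i).le (hc0 i).le) (sq_nonneg _)
    have h2 : ∑ i, x i * c i * (r i - 1) ^ 2 = ∑ i, (x i * r i) * (c i * r i)
        - 2 * ∑ i, x i * (c i * r i) + ∑ i, c i * x i := by
      rw [Finset.mul_sum, ← Finset.sum_sub_distrib, ← Finset.sum_add_distrib]
      exact Finset.sum_congr rfl fun i _ => by ring
    rw [h2, hEx, hEq] at h1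
    linarith
  have hV' : ∑ i, c i * ((1 - h) * x i + h * (x i * r i)) =
      ∑ i, c i * x i - h * (∑ i, c i * x i - E) := by
    rw [← hEx, ← Finset.sum_sub_distrib, Finset.mul_sum, ← Finset.sum_sub_distrib]
    exact Finset.sum_congr rfl fun i _ => by ring
  refine ⟨hE0, hEV, hV', fun hV => ?_⟩
  have hfac := fun i => phys_factor hK hh hε hε2 hhK (hr i)
  have hlog : ∀ i, Real.log (x i) + (h * (r i - 1) - 2 * (h * (r i - 1)) ^ 2) ≤
      Real.log ((1 - h) * x i + h * (x i * r i)) := by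
    intro i
    have e : (1 - h) * x i + h * (x i * r i) = x i * (1 + h * (r i - 1)) := by ring
    rw [e, Real.log_mul (hx i).ne' (by linarith [hfac i])]
    linarith [phys_log_lower (hfac i)]
  have hB : (∑ i, z i * c i * Real.log (x i)) + (h * (E - opt)
      - 2 * h ^ 2 * (K ^ 2 * opt - 2 * E + opt)) ≤
      ∑ i, z i * c i * Real.log ((1 - h) * x i + h * (x i * r i)) := by
    have e : h * (E - opt) - 2 * h ^ 2 * (K ^ 2 * opt - 2 * E + opt) =
        ∑ i, z i * c i * (h * (r i - 1) - 2 * h ^ 2 * (K ^ 2 - 2 * r i + 1)) := by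
      rw [← hEz, ← hopt]
      simp only [Finset.mul_sum, ← Finset.sum_sub_distrib, ← Finset.sum_add_distrib]
      exact Finset.sum_congr rfl fun i _ => by ring
    rw [e, ← Finset.sum_add_distrib]
    refine Finset.sum_le_sum fun i _ => ?_
    rw [← mul_add]
    refine mul_le_mul_of_nonneg_left (le_trans ?_ (hlog i)) (mul_nonneg (hz i) (hc0 i).le)
    have h1 : r i ^ 2 ≤ K ^ 2 := sq_le_sq' (abs_le.mp (hr i)).1 (abs_le.mp (hr i)).2
    have h2 : h ^ 2 * r i ^ 2 ≤ h ^ 2 * K ^ 2 := mul_le_mul_of_nonneg_left h1 (sq_nonneg _)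
    nlinarith
  set V := ∑ i, c i * x i with hVdef
  set V' := ∑ i, c i * ((1 - h) * x i + h * (x i * r i)) with hV'def
  set Bf := ∑ i, z i * c i * Real.log (x i)
  set Bf' := ∑ i, z i * c i * Real.log ((1 - h) * x i + h * (x i * r i))
  have hV0 : 0 < V := lt_trans (by positivity) hV
  have hK2 : 1 ≤ K ^ 2 := one_le_pow₀ hK
  have hh1 : h ≤ ε / 6 := by
    rw [← hhK]; exact le_mul_of_one_le_right hh.le hK2
  have hV'0 : 0 < V' := by
    rw [hV']
    have a1 : 0 < (1 - h) * V := mul_pos (by linarith) hV0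
    have a2 : 0 ≤ h * E := mul_nonneg hh.le hE0
    linarith
  have hVle : V' ≤ V := by
    rw [hV']
    have a1 : 0 ≤ h * (V - E) := mul_nonneg hh.le (by linarith)
    linarith
  have hεo : 0 < ε * opt := mul_pos hε hopt0
  by_cases hcase : (1 + ε / 2) * opt ≤ E
  · have h1 : Real.log V' ≤ Real.log V := Real.log_le_log hV'0 hVle
    have h2 : 18 / ε * Real.log V' ≤ 18 / ε * Real.log V :=
      mul_le_mul_of_nonneg_left h1 (by positivity)
    have h3 : Bf + h * ε / 6 * opt ≤ Bf' := by
      refine le_trans ?_ hB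
      have e1 : h * ε / 6 * opt ≤ h * (E - opt) - 2 * h * (ε / 6) * opt := by
        have : h * ((1 + ε / 2) * opt) ≤ h * E := mul_le_mul_of_nonneg_left hcase hh.le
        linarith
      have e2 : 2 * h ^ 2 * (K ^ 2 * opt - 2 * E + opt) ≤ 2 * h * (ε / 6) * opt := by
        have : 2 * h * (ε / 6) * opt = 2 * h ^ 2 * (K ^ 2 * opt) := by rw [← hhK]; ring
        rw [this]
        apply mul_le_mul_of_nonneg_left _ (by positivity)
        linarith
      linarith
    have h4 : Bf / opt + h * ε / 6 ≤ Bf' / opt := by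
      rw [le_div_iff₀ hopt0, add_mul, div_mul_cancel₀ _ hopt0.ne']
      exact h3
    linarith
  · push Not at hcase
    have h1 : V' ≤ V * (1 - h * ε / 6) := by
      rw [hV']
      have : V * (ε / 6) ≤ V - E := by nlinarith
      have := mul_le_mul_of_nonneg_left this hh.le
      linarith
    have hpos : 0 < 1 - h * ε / 6 := by nlinarith
    have h2 : Real.log V' ≤ Real.log V - h * ε / 6 := by
      refine (Real.log_le_log hV'0 h1).trans ?_
      rw [Real.log_mul hV0.ne' hpos.ne']
      linarith [Real.log_le_sub_one_of_pos hpos]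
    have h2' : 18 / ε * Real.log V' ≤ 18 / ε * Real.log V - 3 * h := by
      have := mul_le_mul_of_nonneg_left h2 (show 0 ≤ 18 / ε by positivity)
      have e : 18 / ε * (Real.log V - h * ε / 6) = 18 / ε * Real.log V - 3 * h := by
        field_simp; ring
      linarith
    have h3 : Bf - 2 * h * opt ≤ Bf' := by
      refine le_trans ?_ hB
      have e1 : 2 * h ^ 2 * (K ^ 2 * opt - 2 * E + opt) ≤ 2 * h * ((ε / 6) * opt + h * opt) := by
        have : 2 * h * ((ε / 6) * opt + h * opt) = 2 * h ^ 2 * (K ^ 2 * opt + opt) := by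
          rw [← hhK]; ring
        rw [this]
        apply mul_le_mul_of_nonneg_left _ (by positivity)
        linarith
      have e2 : h * ((ε / 6) * opt + h * opt) ≤ h * (opt / 2) := by
        apply mul_le_mul_of_nonneg_left _ hh.le
        have : (ε / 6 + h) * opt ≤ (1 / 2) * opt :=
          mul_le_mul_of_nonneg_right (by linarith) hopt0.le
        linarith
      have e3 : 0 ≤ h * E := mul_nonneg hh.le hE0
      linarith
    have h4 : Bf / opt - 2 * h ≤ Bf' / opt := by
      rw [le_div_iff₀ hopt0, sub_mul, div_mul_cancel₀ _ hopt0.ne']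
      exact h3
    have h5 : h * ε / 6 ≤ h := by nlinarith
    linarith

set_option maxHeartbeats 1000000 in
theorem discrete_physarum_convergence :
    ∃ C : ℝ, 0 < C ∧
      ∀ (m n : ℕ) (A : Matrix (Fin m) (Fin n) ℤ), (rmat A).rank = m →
      ∀ (b : Fin m → ℤ) (c : Fin n → ℤ), (∀ i, 0 < c i) →
      ∀ 𝒟 : ℝ, IsGreatest (subdets A) 𝒟 →
      ∀ opt : ℝ,
        IsLeast {val : ℝ | ∃ z : Fin n → ℝ,
          (rmat A *ᵥ z = fun j => (b j : ℝ)) ∧ (∀ i, 0 ≤ z i) ∧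
          val = (fun i => (c i : ℝ)) ⬝ᵥ z} opt →
      ∀ M : ℝ, 1 ≤ M →
      ∀ ε h : ℝ, 0 < ε → ε < 1 / 2 →
        h = ε / 6 * ((∑ i, (c i : ℝ)) ^ 2)⁻¹ * (𝒟 ^ 2)⁻¹ →
      ∀ x : ℕ → Fin n → ℝ,
        (rmat A *ᵥ x 0 = fun j => (b j : ℝ)) →
        (∀ i, M⁻¹ ≤ x 0 i ∧ x 0 i ≤ M) →
        (fun i => (c i : ℝ)) ⬝ᵥ x 0 ≤ M * opt →
        (∀ k : ℕ, x (k + 1) =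
          fun i => (1 - h) * x k i +
            h * physQ (rmat A) (fun j => (b j : ℝ)) (fun i => (c i : ℝ)) (x k) i) →
      ∀ k : ℕ, C * Real.log M / (ε ^ 2 * h ^ 2) ≤ (k : ℝ) →
        (∀ i, 0 < x k i) ∧ (rmat A *ᵥ x k = fun j => (b j : ℝ)) ∧
        opt ≤ (fun i => (c i : ℝ)) ⬝ᵥ x k ∧
        (fun i => (c i : ℝ)) ⬝ᵥ x k ≤ (1 + ε) * opt := by
  refine ⟨1000, by norm_num, ?_⟩
  intro m n A hrank b c hc 𝒟 hD opt hopt M hM ε h hε hε2 hh x hx0 hxM hVM hstep k hk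
  set cr : Fin n → ℝ := fun i => (c i : ℝ) with hcr
  set br : Fin m → ℝ := fun j => (b j : ℝ) with hbr
  have hc1 : ∀ i, 1 ≤ cr i := fun i => by
    have : (1 : ℤ) ≤ c i := hc i
    have h2 : (1 : ℝ) ≤ (c i : ℝ) := by exact_mod_cast this
    exact h2
  have hc0 : ∀ i, 0 < cr i := fun i => lt_of_lt_of_le one_pos (hc1 i)
  have hM0 : 0 < M := by linarith
  have hx0pos : ∀ i, 0 < x 0 i := fun i => lt_of_lt_of_le (inv_pos.mpr hM0) (hxM i).1
  obtain ⟨⟨z, hz1, hz2, hz3⟩, hleast⟩ := hopt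
  have hlow : ∀ y : Fin n → ℝ, rmat A *ᵥ y = br → (∀ i, 0 < y i) → opt ≤ cr ⬝ᵥ y :=
    fun y hy1 hy2 => hleast ⟨y, hy1, fun i => (hy2 i).le, rfl⟩
  rcases Nat.eq_zero_or_pos n with hn | hn
  · subst hn
    have hxx : ∀ k, x k = x 0 := fun k => Subsingleton.elim _ _
    have h0 : opt = 0 := by rw [hz3]; simp [dotProduct]
    refine ⟨fun i => i.elim0, by rw [hxx]; exact hx0, ?_, ?_⟩ <;> simp [h0, dotProduct]
  have hV0pos : 0 < cr ⬝ᵥ x 0 :=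
    Finset.sum_pos (fun i _ => mul_pos (hc0 i) (hx0pos i)) ⟨⟨0, hn⟩, Finset.mem_univ _⟩
  have hopt0 : 0 < opt := by
    by_contra hcon
    push Not at hcon
    nlinarith
  set S := ∑ i, cr i with hS
  have hS1 : 1 ≤ S :=
    (hc1 ⟨0, hn⟩).trans (Finset.single_le_sum (fun i _ => (hc0 i).le) (Finset.mem_univ _))
  have hD1 := phys_one_le A 𝒟 hD
  set K := 𝒟 * S with hKdef
  have hK : 1 ≤ K := by nlinarith
  have hKS : S ≤ K := by nlinarith
  have hh' : h = ε / 6 * (S ^ 2)⁻¹ * (𝒟 ^ 2)⁻¹ := hh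
  have hhpos : 0 < h := by
    rw [hh']
    have : 0 < S := by linarith
    have : 0 < 𝒟 := by linarith
    positivity
  have hhK : h * K ^ 2 = ε / 6 := by
    rw [hh', hKdef]
    have : S ≠ 0 := by linarith
    have : 𝒟 ≠ 0 := by linarith
    field_simp
  have inv : ∀ j, (∀ i, 0 < x j i) ∧ rmat A *ᵥ x j = br := by
    intro j
    induction j with
    | zero => exact ⟨hx0pos, hx0⟩
    | succ j ih =>
      obtain ⟨ih1, ih2⟩ := ih
      obtain ⟨r, E, hq, hrK, hAq, hE⟩ := phys_step A hrank 𝒟 hD br cr (x j) hc1 ih1 ih2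
      rw [hstep j]
      constructor
      · intro i
        change 0 < (1 - h) * x j i + h * physQ (rmat A) br cr (x j) i
        rw [hq i]
        have e : (1 - h) * x j i + h * (x j i * r i) = x j i * (1 + h * (r i - 1)) := by ring
        rw [e]
        have := phys_factor hK hhpos hε hε2 hhK (hrK i)
        exact mul_pos (ih1 i) (by linarith)
      · have e : (fun i => (1 - h) * x j i + h * physQ (rmat A) br cr (x j) i)
            = (1 - h) • x j + h • physQ (rmat A) br cr (x j) := by
          ext i; simp
        rw [e, Matrix.mulVec_add, Matrix.mulVec_smul, Matrix.mulVec_smul, ih2, hAq, ← add_smul]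
        simp
  have hoptsum : ∑ i, cr i * z i = opt := hz3.symm
  have pot : ∀ j, cr ⬝ᵥ x (j + 1) ≤ cr ⬝ᵥ x j ∧ ((1 + ε) * opt < cr ⬝ᵥ x j →
      (∑ i, z i * cr i * Real.log (x j i)) / opt - 18 / ε * Real.log (cr ⬝ᵥ x j) + h * ε / 6 ≤
      (∑ i, z i * cr i * Real.log (x (j + 1) i)) / opt
        - 18 / ε * Real.log (cr ⬝ᵥ x (j + 1))) := by
    intro j
    obtain ⟨ih1, ih2⟩ := inv j
    obtain ⟨r, E, hq, hrK, hAq, hE⟩ := phys_step A hrank 𝒟 hD br cr (x j) hc1 ih1 ih2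
    have hEq : ∑ i, (x j i * r i) * (cr i * r i) = E := by
      rw [← hE _ hAq]
      exact Finset.sum_congr rfl fun i _ => by rw [hq i]
    obtain ⟨p1, p2, p3, p4⟩ := phys_potential cr (x j) z r K h ε opt E hc1 ih1 hz2 hK hrK hhpos
      hε hε2 hhK hoptsum hopt0 (hE z hz1) (hE _ ih2) hEq
    have e : x (j + 1) = fun i => (1 - h) * x j i + h * (x j i * r i) := by
      rw [hstep j]; ext i; rw [hq i]
    rw [e]
    refine ⟨?_, p4⟩
    change ∑ i, cr i * ((1 - h) * x j i + h * (x j i * r i)) ≤ ∑ i, cr i * x j i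
    rw [p3]
    nlinarith
  have anti : Antitone (fun j => cr ⬝ᵥ x j) := antitone_nat_of_succ_le fun j => (pot j).1
  refine ⟨(inv k).1, (inv k).2, hlow _ (inv k).2 (inv k).1, ?_⟩
  by_contra hcon
  push Not at hcon
  have hall : ∀ j, j ≤ k → (1 + ε) * opt < cr ⬝ᵥ x j := fun j hj =>
    lt_of_lt_of_le hcon (anti hj)
  have grow : ∀ j, j ≤ k →
      (∑ i, z i * cr i * Real.log (x 0 i)) / opt - 18 / ε * Real.log (cr ⬝ᵥ x 0)
        + j * (h * ε / 6) ≤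
      (∑ i, z i * cr i * Real.log (x j i)) / opt - 18 / ε * Real.log (cr ⬝ᵥ x j) := by
    intro j
    induction j with
    | zero => intro _; simp
    | succ j ih =>
      intro hj
      have h1 := ih (by omega)
      have h2 := (pot j).2 (hall j (by omega))
      push_cast
      linarith
  have hg := grow k le_rfl
  have hzc : ∀ i, 0 ≤ z i * cr i := fun i => mul_nonneg (hz2 i) (hc0 i).le
  have hzsum : ∑ i, z i * cr i = opt := by
    rw [← hoptsum]; exact Finset.sum_congr rfl fun i _ => mul_comm _ _
  have hB0 : - Real.log M ≤ (∑ i, z i * cr i * Real.log (x 0 i)) / opt := by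
    rw [le_div_iff₀ hopt0]
    nth_rewrite 1 [← hzsum]
    rw [Finset.mul_sum]
    refine Finset.sum_le_sum fun i _ => ?_
    rw [mul_comm]
    refine mul_le_mul_of_nonneg_left ?_ (hzc i)
    rw [← Real.log_inv]
    exact Real.log_le_log (inv_pos.mpr hM0) (hxM i).1
  have hV0le : cr ⬝ᵥ x 0 ≤ M * S := by
    rw [hS, Finset.mul_sum]
    refine Finset.sum_le_sum fun i _ => ?_
    rw [mul_comm]
    exact mul_le_mul_of_nonneg_right (hxM i).2 (hc0 i).le
  have hxk : ∀ i, x k i ≤ M * S := by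
    intro i
    have h1 : cr i * x k i ≤ cr ⬝ᵥ x k :=
      Finset.single_le_sum (f := fun i => cr i * x k i)
        (fun i _ => mul_nonneg (hc0 i).le ((inv k).1 i).le) (Finset.mem_univ i)
    have h2 : cr ⬝ᵥ x k ≤ cr ⬝ᵥ x 0 := anti (Nat.zero_le k)
    have h3 : x k i ≤ cr i * x k i := by nlinarith [hc1 i, (inv k).1 i]
    linarith
  have hSpos : 0 < S := by linarith
  have hBk : (∑ i, z i * cr i * Real.log (x k i)) / opt ≤ Real.log M + S := by
    rw [div_le_iff₀ hopt0]
    nth_rewrite 1 [← hzsum]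
    rw [Finset.mul_sum]
    refine Finset.sum_le_sum fun i _ => ?_
    rw [mul_comm]
    refine mul_le_mul_of_nonneg_right ?_ (hzc i)
    refine (Real.log_le_log ((inv k).1 i) (hxk i)).trans ?_
    rw [Real.log_mul hM0.ne' hSpos.ne']
    linarith [Real.log_le_sub_one_of_pos hSpos]
  have hlogV : Real.log (cr ⬝ᵥ x 0) - Real.log (cr ⬝ᵥ x k) ≤ Real.log M := by
    have h1 : Real.log (cr ⬝ᵥ x 0) ≤ Real.log M + Real.log opt := by
      rw [← Real.log_mul hM0.ne' hopt0.ne']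
      exact Real.log_le_log hV0pos hVM
    have h2 : Real.log opt ≤ Real.log (cr ⬝ᵥ x k) :=
      Real.log_le_log hopt0 (hlow _ (inv k).2 (inv k).1)
    linarith
  have hM1 : 1 + ε < M := by
    have := hall 0 (Nat.zero_le _)
    by_contra hcc
    push Not at hcc
    nlinarith
  have hlogM : ε / 2 ≤ Real.log M := by
    have h1 : Real.log (1 + ε) ≤ Real.log M := Real.log_le_log (by linarith) hM1.le
    have h2 := Real.one_sub_inv_le_log_of_pos (show 0 < 1 + ε by linarith)
    have h3 : ε / 2 ≤ 1 - (1 + ε)⁻¹ := by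
      have : 1 - (1 + ε)⁻¹ - ε / 2 = ε * (1 - ε) / (2 * (1 + ε)) := by field_simp; ring
      have : 0 ≤ ε * (1 - ε) / (2 * (1 + ε)) :=
        div_nonneg (mul_nonneg hε.le (by linarith)) (by linarith)
      linarith
    linarith
  set ℓ := Real.log M with hℓ
  have hlogV' : 18 / ε * (Real.log (cr ⬝ᵥ x 0) - Real.log (cr ⬝ᵥ x k)) ≤ 18 / ε * ℓ :=
    mul_le_mul_of_nonneg_left hlogV (by positivity)
  have hmain : (k : ℝ) * (h * ε / 6) ≤ 2 * ℓ + S + 18 / ε * ℓ := by linarith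
  have hℓ0 : 0 < ℓ := by linarith
  have hmain2 : (k : ℝ) * (h * ε / 6) * ε ≤ 21 * S * ℓ := by
    have h1 := mul_le_mul_of_nonneg_right hmain hε.le
    have e : (2 * ℓ + S + 18 / ε * ℓ) * ε = 2 * ℓ * ε + S * ε + 18 * ℓ := by
      field_simp
    rw [e] at h1
    have h2 : S * ε ≤ S * (2 * ℓ) := mul_le_mul_of_nonneg_left (by linarith) hSpos.le
    have h3 : ℓ ≤ S * ℓ := by nlinarith
    have h4 : 2 * ℓ * ε ≤ ℓ := by nlinarith
    linarith
  have hk2 : 1000 * ℓ ≤ (k : ℝ) * (ε ^ 2 * h ^ 2) := by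
    rwa [div_le_iff₀ (by positivity)] at hk
  have hSh : S * h ≤ 1 := by
    have a1 : K ≤ K ^ 2 := le_self_pow₀ hK two_ne_zero
    have a2 : h * S ≤ h * K ^ 2 := mul_le_mul_of_nonneg_left (by linarith) hhpos.le
    linarith
  have h5 : (k : ℝ) * (ε ^ 2 * h ^ 2) ≤ 126 * ℓ * (S * h) := by
    have := mul_le_mul_of_nonneg_right hmain2 (show 0 ≤ 6 * h by positivity)
    linarith
  have h6 : 126 * ℓ * (S * h) ≤ 126 * ℓ * 1 := mul_le_mul_of_nonneg_left hSh (by linarith)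
  linarith
end
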